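/- arXiv:2105.11633 — 5 statements merged into one kernel-verified Lean document; each statement's English description precedes it below -/
import Mathlib

section
/- Let G be a connected simple graph on a finite vertex set with at most 10 vertices, and let P and Q be two longest paths in G with V(P) ≠ V(Q). Then V(P) ∩ V(Q) is a separator of G; that is, the subgraph of G induced on V(G) \ (V(P) ∩ V(Q)) is not connected. -/
open SimpleGraph

/-- `P` is a longest path in the simple graph `G`: it is a path, and every path in `G`
has length at most the length of `P`. -/
def IsLongestPath {V : Type*} (G : SimpleGraph V) {u v : V} (P : G.Walk u v) : Prop :=
  P.IsPath ∧ ∀ {a b : V} (Q : G.Walk a b), Q.IsPath → Q.length ≤ P.length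

namespace LongestPathSeparator

/-! ### A kernel-evaluable search -/

/-- Evaluates `n` to a literal before passing it to `f`. -/
def force {α : Type} (n : ℕ) (f : ℕ → α) : α :=
  Nat.rec (f 0) (fun m _ => f (Nat.succ m)) n

/-- Evaluates all entries of a list to literals before passing it to `f`. -/
def forceList {α : Type} : List ℕ → (List ℕ → α) → α
  | [], f => f []
  | x :: l, f => force x fun y => forceList l fun l' => f (y :: l')

/-- The number of the unordered pair `{x, y}` of labels in `{0, …, 10}`. -/
def pairCode (x y : ℕ) : ℕ := 11 * min x y + max x y

/-- The set of pairs (as a bit mask) consisting of `{x, y}` only. -/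
def pairBit (x y : ℕ) : ℕ := 1 <<< pairCode x y

/-- The bitwise union of `g x` over the entries `x` of a list. -/
def unionMask (g : ℕ → ℕ) : List ℕ → ℕ
  | [] => 0
  | x :: l => g x ||| unionMask g l

/-- The set of all pairs containing `x`. -/
def star (x : ℕ) : ℕ := unionMask (fun y => bif y == x then 0 else pairBit x y) (List.range 11)

/-- `m` without its least element. -/
def dropLow (m : ℕ) : ℕ := Nat.land m (Nat.pred m)

/-- Unit propagation: `K` is a set of pairs known to be present, `A` the set of pairs still allowed,
and no mask in the list may consist of present pairs only. -/
def scan (K : ℕ) : List ℕ → ℕ → List ℕ → (ℕ → List ℕ → Bool) → Bool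
  | [], A, acc, f => f A acc
  | t :: ts, A, acc, f =>
    bif Nat.beq (Nat.land t A) t then
      force (Nat.xor t (Nat.land t K)) fun r =>
        bif Nat.beq r 0 then true
        else bif Nat.beq r (Nat.shiftLeft 1 (Nat.log2 r)) then
          force (Nat.xor A (Nat.land A r)) fun A' => scan K ts A' acc f
        else scan K ts A (r :: acc) f
    else scan K ts A acc f

/-- Degree propagation: every mask in the list contains exactly two present pairs. -/
def degs : List ℕ → ℕ → ℕ → (ℕ → ℕ → Bool) → Bool
  | [], K, A, f => f K A
  | s :: ss, K, A, f =>
    force (Nat.land A s) fun y => force (dropLow y) fun y' =>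
      bif Nat.beq y' 0 then true
      else bif Nat.beq (dropLow y') 0 then force (Nat.lor K y) fun K' => degs ss K' A f
      else force (Nat.land K s) fun x => force (dropLow x) fun x' =>
        bif Nat.beq x' 0 then degs ss K A f
        else bif Nat.beq (dropLow x') 0 then
          force (Nat.lor (Nat.xor A y) x) fun A' => degs ss K A' f
        else true

/-- The first nonempty intersection of `D` with a mask of the list. -/
def pick (D : ℕ) : List ℕ → ℕ
  | [] => 0
  | s :: ss => force (Nat.land D s) fun m => bif Nat.beq m 0 then pick D ss else m

/-- Every label in `c` is joined to at least two labels in `c`. -/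
def isClosed (K : ℕ) (c : List ℕ) : Bool :=
  c.all fun x => Nat.ble 2 (c.countP fun y => K.testBit (pairCode x y))

/-- The present pairs contain a cycle of length three or four avoiding the label `10`. -/
def hasShortCycle (K : ℕ) : Bool :=
  ((List.range 10).sublistsLen 3).any (isClosed K) ||
    ((List.range 10).sublistsLen 4).any (isClosed K)

/-- Backtracking search refuting the existence of a set of pairs `M` with `K ⊆ M ⊆ A` which has two
elements in every member of `stars`, contains no member of `T` and no short cycle. -/
def refute (stars : List ℕ) : ℕ → ℕ → ℕ → List ℕ → Bool
  | 0, _, _, _ => false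
  | n + 1, K, A, T =>
    scan K T A [] fun A₁ T₁ => degs stars K A₁ fun K₂ A₂ =>
      bif and (Nat.beq K₂ K) (Nat.beq A₂ A) then
        force (pick (Nat.xor A₂ K₂) stars) fun m =>
          bif Nat.beq m 0 then hasShortCycle K₂
          else force (Nat.shiftLeft 1 (Nat.log2 m)) fun e =>
            (force (Nat.lor K₂ e) fun K₃ => refute stars n K₃ A₂ T₁) &&
            (force (Nat.xor A₂ (Nat.land A₂ e)) fun A₃ => refute stars n K₂ A₃ T₁)
      else refute stars n K₂ A₂ T₁

/-- The last `n` decimal digits of a number, lowest first. -/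
def lastDigits : ℕ → ℕ → List ℕ
  | 0, _ => []
  | n + 1, t => t % 10 :: lastDigits n (t / 10)

/-- Adjacency in the graph consisting of the path `0, 1, …, k - 1` and the edge `{i, k}`. -/
def isBase (k i x y : ℕ) : Bool :=
  (x + 1 == y && Nat.blt y k) || (y + 1 == x && Nat.blt x k) ||
    (x == i && y == k) || (x == k && y == i)

/-- The set of those pairs of consecutive entries which are not base edges. -/
def pathMask (k i : ℕ) : List ℕ → ℕ
  | [] => 0
  | x :: l => match l with
    | [] => 0
    | y :: _ => (bif isBase k i x y then 0 else pairBit x y) ||| pathMask k i l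

/-- The masks of the paths with `k + 1` vertices among the given digit sequences. -/
def pathMasks (k i : ℕ) : List ℕ → List ℕ
  | [] => []
  | t :: ts =>
    bif decide (lastDigits (k + 1) t).Nodup then
      pathMask k i (lastDigits (k + 1) t) :: pathMasks k i ts
    else pathMasks k i ts

/-- Tests all sublists of a list. -/
def allSublists : List ℕ → (List ℕ → Bool) → Bool
  | [], f => f []
  | x :: l, f => allSublists l f && allSublists l fun s => f (x :: s)

/-- The labels of the second path: `S` is the set of the labels it shares with the first one. The
label `10` stands for an additional vertex joining the two ends of the path. -/
def labels (k : ℕ) (S : List ℕ) : List ℕ :=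
  k :: (S ++ (List.range' (k + 1) (k - S.length - 1) ++ [10]))

/-- The set of all pairs of distinct entries of `l`. -/
def allPairs (l : List ℕ) : ℕ :=
  unionMask (fun x => unionMask (fun y => bif y == x then 0 else pairBit x y) l) l

/-- The search for a fixed set `S` of common labels. -/
def refuteShared (k : ℕ) (T S : List ℕ) : Bool :=
  Nat.blt 10 (2 * k - S.length) ||
    forceList ((labels k S).map star) fun stars =>
      force (allPairs (labels k S)) fun A => refute stars 100 0 A T

/-- The search for all sets of common labels. -/
def refuteAll (k i : ℕ) (T : List ℕ) : Bool :=
  forceList (pathMasks k i T) fun T' =>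
    allSublists ((List.range k).filter fun x => !(x == i)) fun S => refuteShared k T' S

/-! ### Soundness of the search -/

theorem force_eq {α : Type} (n : ℕ) (f : ℕ → α) : force n f = f n := by
  cases n <;> rfl

theorem forceList_eq {α : Type} (l : List ℕ) (f : List ℕ → α) : forceList l f = f l := by
  induction l generalizing f with
  | nil => rfl
  | cons x l ih => simp [forceList, force_eq, ih]

theorem testBit_natLand (a b i : ℕ) : (Nat.land a b).testBit i = (a.testBit i && b.testBit i) :=
  Nat.testBit_and a b i

theorem testBit_natLor (a b i : ℕ) : (Nat.lor a b).testBit i = (a.testBit i || b.testBit i) :=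
  Nat.testBit_or a b i

theorem testBit_natXor (a b i : ℕ) : (Nat.xor a b).testBit i = (a.testBit i ^^ b.testBit i) :=
  Nat.testBit_xor a b i

theorem testBit_natShiftLeft_one (n i : ℕ) :
    (Nat.shiftLeft 1 n).testBit i = decide (i = n) := by
  change (1 <<< n).testBit i = _
  rw [Nat.one_shiftLeft, Nat.testBit_two_pow]
  simp [eq_comm]

theorem exists_testBit_dropLow {n : ℕ} (hn : n ≠ 0) :
    ∃ i, n.testBit i ∧ ∀ j, (dropLow n).testBit j = (n.testBit j && decide (j ≠ i)) := by
  induction n using Nat.binaryRec with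
  | zero => exact absurd rfl hn
  | bit b n ih =>
    cases b with
    | true =>
      refine ⟨0, by simp, fun j => ?_⟩
      have : dropLow (Nat.bit true n) = Nat.bit false n := by
        change Nat.bit true n &&& (Nat.bit true n - 1) = _
        have h : Nat.bit true n - 1 = Nat.bit false n := by simp [Nat.bit_val]
        rw [h, Nat.land_bit]
        simp
      rw [this]
      cases j with
      | zero => simp
      | succ j => rw [Nat.testBit_bit_succ, Nat.testBit_bit_succ]; simp
    | false =>
      have hn' : n ≠ 0 := by rintro rfl; simp at hn
      obtain ⟨i, hi, h⟩ := ih hn'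
      refine ⟨i + 1, by rwa [Nat.testBit_bit_succ], fun j => ?_⟩
      have : dropLow (Nat.bit false n) = Nat.bit false (dropLow n) := by
        change Nat.bit false n &&& (Nat.bit false n - 1) = Nat.bit false (n &&& (n - 1))
        have h : Nat.bit false n - 1 = Nat.bit true (n - 1) := by
          simp only [Nat.bit_val, Bool.toNat_false, Bool.toNat_true]
          omega
        rw [h, Nat.land_bit]
        simp
      rw [this]
      cases j with
      | zero => simp
      | succ j => rw [Nat.testBit_bit_succ, Nat.testBit_bit_succ, h j]; simp

theorem dropLow_eq_zero {n : ℕ} (h : dropLow n = 0) (i j : ℕ) (hi : n.testBit i)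
    (hj : n.testBit j) : i = j := by
  rcases eq_or_ne n 0 with rfl | hn
  · simp at hi
  obtain ⟨l, -, hl⟩ := exists_testBit_dropLow hn
  have h1 := hl i
  have h2 := hl j
  simp_all

section Soundness

variable {M : ℕ → Prop}

/-- Exactly two elements of the mask `s` satisfy `M`. -/
def MeetsTwice (M : ℕ → Prop) (s : ℕ) : Prop :=
  ∃ i j, i ≠ j ∧ ∀ l, (M l ∧ s.testBit l) ↔ l = i ∨ l = j

/-- `M` lies between the masks `K` and `A`. -/
def Between (M : ℕ → Prop) (K A : ℕ) : Prop :=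
  (∀ i, K.testBit i → M i) ∧ ∀ i, M i → A.testBit i

theorem scan_sound {K : ℕ} {f : ℕ → List ℕ → Bool}
    (hf : ∀ A T, Between M K A → (∀ t ∈ T, ¬ ∀ i, t.testBit i → M i) → f A T ≠ true)
    (T : List ℕ) : ∀ (A : ℕ) (acc : List ℕ), Between M K A →
      (∀ t ∈ T, ¬ ∀ i, t.testBit i → M i) → (∀ t ∈ acc, ¬ ∀ i, t.testBit i → M i) →
      scan K T A acc f ≠ true := by
  induction T with
  | nil => exact fun A acc hA _ hacc => hf A acc hA hacc
  | cons t ts ih =>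
    intro A acc hA hT hacc
    have ht := hT t (by simp)
    have hts : ∀ t ∈ ts, ¬ ∀ i, t.testBit i → M i := fun t h => hT t (by simp [h])
    have hr : ¬ ∀ i, (Nat.xor t (Nat.land t K)).testBit i → M i := by
      intro h
      refine ht fun i hi => ?_
      have := h i
      have := hA.1 i
      simp only [testBit_natXor, testBit_natLand] at *
      cases h : K.testBit i <;> simp_all
    rw [scan, cond_eq_ite, force_eq]
    split_ifs
    · generalize Nat.xor t (Nat.land t K) = r at hr
      rw [cond_eq_ite, cond_eq_ite, force_eq]
      split_ifs with h1 h2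
      · rw [Nat.beq_eq] at h1
        subst h1
        simp at hr
      · refine ih _ _ ⟨hA.1, fun i hi => ?_⟩ hts hacc
        rw [Nat.beq_eq] at h2
        have h3 := hA.2 i hi
        have h4 : r.testBit i = false := by
          by_contra h4
          generalize Nat.log2 r = e at h2
          subst h2
          refine hr fun j hj => ?_
          rw [testBit_natShiftLeft_one] at h4 hj
          simp_all
        rw [testBit_natXor, testBit_natLand, h3, h4]
        rfl
      · exact ih _ _ hA hts (List.forall_mem_cons.2 ⟨hr, hacc⟩)
    · exact ih _ _ hA hts hacc

theorem degs_sound {f : ℕ → ℕ → Bool} (hf : ∀ K A, Between M K A → f K A ≠ true)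
    (S : List ℕ) : ∀ K A, Between M K A → (∀ s ∈ S, MeetsTwice M s) → degs S K A f ≠ true := by
  induction S with
  | nil => exact fun K A h _ => hf K A h
  | cons s ss ih =>
    intro K A hA hS
    obtain ⟨i, j, hij, hs⟩ := hS s (by simp)
    have hss : ∀ s ∈ ss, MeetsTwice M s := fun t h => hS t (by simp [h])
    have hi := (hs i).2 (by simp)
    have hj := (hs j).2 (by simp)
    have hy (l) : (Nat.land A s).testBit l = (A.testBit l && s.testBit l) := testBit_natLand ..
    have hx (l) : (Nat.land K s).testBit l = (K.testBit l && s.testBit l) := testBit_natLand ..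
    have hyi : (Nat.land A s).testBit i := by rw [hy, hi.2, hA.2 i hi.1]; rfl
    have hyj : (Nat.land A s).testBit j := by rw [hy, hj.2, hA.2 j hj.1]; rfl
    rw [degs]
    simp only [force_eq, cond_eq_ite, Nat.beq_eq]
    generalize Nat.land A s = y at hy hyi hyj ⊢
    generalize Nat.land K s = x at hx ⊢
    split_ifs with h1 h2 h3 h4
    · exact absurd (dropLow_eq_zero h1 i j hyi hyj) hij
    · refine ih _ _ ⟨fun l hl => ?_, hA.2⟩ hss
      rw [testBit_natLor, Bool.or_eq_true] at hl
      rcases hl with hl | hl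
      · exact hA.1 l hl
      · obtain ⟨c, hc, hc'⟩ := exists_testBit_dropLow (n := y) (by rintro rfl; simp at hyi)
        have key (m) (hm : y.testBit m) : m = c ∨ (dropLow y).testBit m := by
          rw [hc', hm]; by_cases m = c <;> simp_all
        have key2 := dropLow_eq_zero h2
        have : l = i ∨ l = j := by
          rcases key i hyi with h5 | h5 <;> rcases key j hyj with h6 | h6 <;>
            rcases key l hl with h7 | h7
          · exact .inl (h7.trans h5.symm)
          · exact (hij (h5.trans h6.symm)).elim
          · exact .inl (h7.trans h5.symm)
          · exact .inr (key2 _ _ h7 h6)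
          · exact .inr (h7.trans h6.symm)
          · exact .inl (key2 _ _ h7 h5)
          · exact (hij (key2 _ _ h5 h6)).elim
          · exact (hij (key2 _ _ h5 h6)).elim
        exact ((hs l).2 this).1
    · exact ih _ _ hA hss
    · refine ih _ _ ⟨hA.1, fun l hl => ?_⟩ hss
      have h5 := hA.2 l hl
      rw [testBit_natLor, testBit_natXor, hy, h5]
      cases h6 : s.testBit l
      · simp
      · obtain ⟨c, hc, hc'⟩ := exists_testBit_dropLow (n := x) (by rintro rfl; simp [dropLow] at h3)
        obtain ⟨d, hd, hd'⟩ := exists_testBit_dropLow h3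
        rw [hc'] at hd
        have hcM := (hs c).1
        have hdM := (hs d).1
        have hlM := (hs l).1 ⟨hl, h6⟩
        have := hA.1 c
        have := hA.1 d
        have hxc := hx c
        have hxd := hx d
        have : l = c ∨ l = d := by grind
        rcases this with rfl | rfl
        · rw [hc]; simp
        · have : x.testBit l := by grind
          rw [this]; simp
    · obtain ⟨c, hc, hc'⟩ := exists_testBit_dropLow (n := x) (by rintro rfl; simp [dropLow] at h3)
      obtain ⟨d, hd, hd'⟩ := exists_testBit_dropLow h3
      obtain ⟨e, he, he'⟩ := exists_testBit_dropLow h4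
      rw [hd'] at he
      rw [hc'] at hd he
      have hcM := (hs c).1
      have hdM := (hs d).1
      have heM := (hs e).1
      have := hA.1 c
      have := hA.1 d
      have := hA.1 e
      have hxc := hx c
      have hxd := hx d
      have hxe := hx e
      grind

/-- Every nonempty finite set of labels below `10` has an element joined to at most one element of
the set. -/
def NoClosedSet (M : ℕ → Prop) : Prop :=
  ∀ c : List ℕ, c ≠ [] → (∀ x ∈ c, x < 10) →
    ¬ ∀ x ∈ c, ∃ y ∈ c, ∃ z ∈ c, y ≠ z ∧ M (pairCode x y) ∧ M (pairCode x z)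

theorem hasShortCycle_sound {K : ℕ} (hK : ∀ i, K.testBit i → M i) (hM : NoClosedSet M) :
    hasShortCycle K ≠ true := by
  have key (c : List ℕ) (n : ℕ) (h : c ∈ (List.range 10).sublistsLen (n + 1)) :
      isClosed K c ≠ true := by
    rw [List.mem_sublistsLen] at h
    intro hc
    refine hM c (by rintro rfl; simp at h) (fun x hx => List.mem_range.1 (h.1.subset hx)) ?_
    intro x hx
    have hx' := List.all_eq_true.1 hc x hx
    rw [Nat.ble_eq, List.countP_eq_length_filter] at hx'
    have hd := ((List.nodup_range (n := 10)).sublist h.1).filter fun y => K.testBit (pairCode x y)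
    have hmem (y) (hy : y ∈ c.filter fun y => K.testBit (pairCode x y)) :
        y ∈ c ∧ M (pairCode x y) := by
      rw [List.mem_filter] at hy
      exact ⟨hy.1, hK _ hy.2⟩
    generalize c.filter (fun y => K.testBit (pairCode x y)) = F at hx' hd hmem
    match F with
    | [] => simp at hx'
    | [_] => simp at hx'
    | y :: z :: _ =>
      have hy := hmem y (by simp)
      have hz := hmem z (by simp)
      exact ⟨y, hy.1, z, hz.1, by rintro rfl; simp at hd, hy.2, hz.2⟩
  intro h
  rw [hasShortCycle, Bool.or_eq_true, List.any_eq_true, List.any_eq_true] at h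
  rcases h with ⟨c, hc, h⟩ | ⟨c, hc, h⟩
  · exact key c 2 hc h
  · exact key c 3 hc h

theorem refute_sound {stars : List ℕ} (hstars : ∀ s ∈ stars, MeetsTwice M s)
    (hM : NoClosedSet M) (n : ℕ) : ∀ (K A : ℕ) (T : List ℕ), Between M K A →
      (∀ t ∈ T, ¬ ∀ i, t.testBit i → M i) → refute stars n K A T ≠ true := by
  induction n with
  | zero => intro K A T _ _; simp [refute]
  | succ n ih =>
    intro K A T hA hT
    rw [refute]
    refine scan_sound (fun A₁ T₁ hA₁ hT₁ => ?_) T A [] hA hT (by simp)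
    refine degs_sound (fun K₂ A₂ hA₂ => ?_) stars K A₁ hA₁ hstars
    simp only [force_eq, cond_eq_ite, Nat.beq_eq]
    split_ifs with h1 h2
    · exact hasShortCycle_sound hA₂.1 hM
    · generalize Nat.log2 _ = e
      rw [ne_eq, Bool.and_eq_true, not_and_or]
      by_cases he : M e
      · refine .inl (ih _ _ _ ⟨fun i hi => ?_, hA₂.2⟩ hT₁)
        rw [testBit_natLor, testBit_natShiftLeft_one, Bool.or_eq_true, decide_eq_true_iff] at hi
        rcases hi with hi | rfl
        · exact hA₂.1 i hi
        · exact he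
      · refine .inr (ih _ _ _ ⟨hA₂.1, fun i hi => ?_⟩ hT₁)
        have h3 : decide (i = e) = false := by
          rw [decide_eq_false_iff_not]
          rintro rfl
          exact he hi
        rw [testBit_natXor, testBit_natLand, testBit_natShiftLeft_one, hA₂.2 i hi, h3]
        rfl
    · exact ih _ _ _ hA₂ hT₁

theorem testBit_unionMask (g : ℕ → ℕ) (l : List ℕ) (i : ℕ) :
    (unionMask g l).testBit i ↔ ∃ x ∈ l, (g x).testBit i := by
  induction l with
  | nil => simp [unionMask]
  | cons x l ih => simp [unionMask, ih]

theorem testBit_pairBit (x y i : ℕ) : (pairBit x y).testBit i ↔ i = pairCode x y := by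
  rw [pairBit, Nat.one_shiftLeft, Nat.testBit_two_pow]
  simp [eq_comm]

theorem testBit_star (x i : ℕ) :
    (star x).testBit i ↔ ∃ y, y ≤ 10 ∧ y ≠ x ∧ i = pairCode x y := by
  rw [star, testBit_unionMask]
  refine exists_congr fun y => ?_
  rw [List.mem_range, cond_eq_ite]
  split_ifs with h <;> simp_all [testBit_pairBit, Nat.lt_succ_iff]

theorem testBit_allPairs (l : List ℕ) (i : ℕ) :
    (allPairs l).testBit i ↔ ∃ x ∈ l, ∃ y ∈ l, y ≠ x ∧ i = pairCode x y := by
  simp only [allPairs, testBit_unionMask]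
  refine exists_congr fun x => and_congr_right fun _ => exists_congr fun y =>
    and_congr_right fun _ => ?_
  rw [cond_eq_ite]
  split_ifs with h <;> simp_all [testBit_pairBit]

theorem pairCode_comm (x y : ℕ) : pairCode x y = pairCode y x := by
  rw [pairCode, pairCode, min_comm, max_comm]

theorem pairCode_inj {x y x' y' : ℕ} (hx : x ≤ 10) (hy : y ≤ 10) (hx' : x' ≤ 10) (hy' : y' ≤ 10)
    (h : pairCode x y = pairCode x' y') : (x = x' ∧ y = y') ∨ (x = y' ∧ y = x') := by
  rw [pairCode, pairCode] at h
  omega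

theorem of_testBit_pathMask {k i : ℕ} {l : List ℕ} (h : ∀ j, (pathMask k i l).testBit j → M j) :
    l.IsChain fun x y => isBase k i x y ∨ M (pairCode x y) := by
  induction l with
  | nil => simp
  | cons x l ih =>
    match l with
    | [] => simp
    | y :: l =>
      rw [List.isChain_cons_cons]
      refine ⟨?_, ih fun j hj => h j ?_⟩
      · by_cases hb : isBase k i x y
        · exact .inl hb
        · refine .inr (h _ ?_)
          simp [pathMask, hb, testBit_pairBit]
      · rw [pathMask, Nat.testBit_or, hj, Bool.or_true]

theorem not_of_mem_pathMasks {k i : ℕ} (T : List ℕ)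
    (hM : ∀ l : List ℕ, l.Nodup → l.length = k + 1 → (∀ x ∈ l, x < 10) →
      ¬ l.IsChain fun x y => isBase k i x y ∨ M (pairCode x y)) :
    ∀ t ∈ pathMasks k i T, ¬ ∀ j, t.testBit j → M j := by
  have hlen (n t : ℕ) : (lastDigits n t).length = n := by
    induction n generalizing t <;> simp_all [lastDigits]
  have hlt (n t : ℕ) : ∀ x ∈ lastDigits n t, x < 10 := by
    induction n generalizing t with
    | zero => simp [lastDigits]
    | succ n ih =>
      rw [lastDigits, List.forall_mem_cons]
      exact ⟨Nat.mod_lt _ (by norm_num), ih _⟩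
  induction T with
  | nil => simp [pathMasks]
  | cons t T ih =>
    rw [pathMasks, cond_eq_ite]
    split_ifs with h
    · rw [List.forall_mem_cons]
      refine ⟨fun h' => hM _ (of_decide_eq_true h) (hlen _ _) (hlt _ _) ?_, ih⟩
      exact of_testBit_pathMask h'
    · exact ih

theorem allSublists_sound {l : List ℕ} {f : List ℕ → Bool} (h : allSublists l f) {s : List ℕ}
    (hs : s.Sublist l) : f s := by
  induction l generalizing f s with
  | nil => rw [List.sublist_nil] at hs; subst hs; exact h
  | cons x l ih =>
    rw [allSublists, Bool.and_eq_true] at h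
    rcases hs with _ | ⟨_, h'⟩ | ⟨_, h'⟩
    · exact ih h.1 h'
    · exact ih h.2 h'

theorem refuteAll_sound {k i : ℕ} {T S : List ℕ}
    (hS : S.Sublist ((List.range k).filter fun x => !(x == i))) (hk : 2 * k - S.length ≤ 10)
    (hpairs : ∀ e, M e → ∃ x ∈ labels k S, ∃ y ∈ labels k S, y ≠ x ∧ e = pairCode x y)
    (hstars : ∀ x ∈ labels k S, MeetsTwice M (star x)) (hM : NoClosedSet M)
    (hpaths : ∀ l : List ℕ, l.Nodup → l.length = k + 1 → (∀ x ∈ l, x < 10) →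
      ¬ l.IsChain fun x y => isBase k i x y ∨ M (pairCode x y)) :
    refuteAll k i T ≠ true := by
  intro h
  rw [refuteAll, forceList_eq] at h
  have := allSublists_sound h hS
  rw [refuteShared, Bool.or_eq_true, Nat.blt_eq, forceList_eq, force_eq] at this
  refine refute_sound (by simpa using hstars) hM _ _ _ _ ⟨by simp, fun e he => ?_⟩
    (not_of_mem_pathMasks T hpaths) (this.resolve_left (by omega))
  rw [testBit_allPairs]
  exact hpairs e he

end Soundness

/-! ### The pairs of labels used by a closed walk -/

section Cycle

variable {k : ℕ} (τ : Fin (k + 1) → ℕ)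

/-- The codes of the pairs of cyclically consecutive values of `τ`. -/
def CyclePairs (e : ℕ) : Prop := ∃ j, e = pairCode (τ j) (τ (j + 1))

variable {τ}

theorem cyclePairs_pairCode_iff (hle : ∀ j, τ j ≤ 10) {x y : ℕ} (hx : x ≤ 10)
    (hy : y ≤ 10) : CyclePairs τ (pairCode x y) ↔
      ∃ j, (x = τ j ∧ y = τ (j + 1)) ∨ (x = τ (j + 1) ∧ y = τ j) := by
  refine exists_congr fun j => ⟨pairCode_inj hx hy (hle _) (hle _), ?_⟩
  rintro (⟨rfl, rfl⟩ | ⟨rfl, rfl⟩)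
  · rfl
  · exact pairCode_comm _ _

theorem cyclePairs_star_iff (hτ : τ.Injective) (hle : ∀ j, τ j ≤ 10) (j : Fin (k + 1)) {y : ℕ}
    (hy : y ≤ 10) :
    CyclePairs τ (pairCode (τ j) y) ↔ y = τ (j + 1) ∨ y = τ (j - 1) := by
  rw [cyclePairs_pairCode_iff hle (hle j) hy]
  constructor
  · rintro ⟨m, ⟨h, rfl⟩ | ⟨h, rfl⟩⟩
    · rw [hτ h]; exact .inl rfl
    · rw [hτ h, add_sub_cancel_right]; exact .inr rfl
  · rintro (rfl | rfl)
    · exact ⟨j, .inl ⟨rfl, rfl⟩⟩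
    · exact ⟨j - 1, .inr ⟨by rw [sub_add_cancel], rfl⟩⟩

theorem meetsTwice_cyclePairs (hτ : τ.Injective) (hle : ∀ j, τ j ≤ 10) (hk : 2 ≤ k)
    (j : Fin (k + 1)) : MeetsTwice (CyclePairs τ) (star (τ j)) := by
  have h1 : (1 : Fin (k + 1)) ≠ 0 := by
    rw [ne_eq, Fin.one_eq_zero_iff]; omega
  have h2 : j + 1 ≠ j - 1 := by
    intro h
    have h3 : (1 : Fin (k + 1)) + 1 = 0 := by
      have := congrArg (fun x => x - j + 1) h
      simpa using this
    have h4 := congrArg Fin.val h3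
    rw [Fin.val_add, Fin.val_one', Fin.val_zero, Nat.mod_eq_of_lt (a := 1) (by omega),
      Nat.mod_eq_of_lt (by omega)] at h4
    omega
  refine ⟨pairCode (τ j) (τ (j + 1)), pairCode (τ j) (τ (j - 1)), fun h => ?_, fun l => ?_⟩
  · rcases pairCode_inj (hle _) (hle _) (hle _) (hle _) h with h | h
    · exact h2 (hτ h.2)
    · exact h2 (hτ (h.2.trans h.1))
  · rw [testBit_star]
    constructor
    · rintro ⟨hl, y, hy, -, rfl⟩
      rcases (cyclePairs_star_iff hτ hle j hy).1 hl with rfl | rfl <;> simp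
    · rintro (rfl | rfl)
      · exact ⟨(cyclePairs_star_iff hτ hle j (hle _)).2 (.inl rfl), _, hle _,
          fun h => h1 (by simpa using hτ h), rfl⟩
      · exact ⟨(cyclePairs_star_iff hτ hle j (hle _)).2 (.inr rfl), _, hle _,
          fun h => h1 (by simpa using hτ h), rfl⟩

theorem noClosedSet_cyclePairs (hτ : τ.Injective) (hle : ∀ j, τ j ≤ 10)
    (hlast : τ (Fin.last k) = 10) : NoClosedSet (CyclePairs τ) := by
  intro c hc hlt h
  have hex : ∃ j, τ j ∈ c := by
    obtain ⟨x, hx⟩ := List.exists_mem_of_ne_nil c hc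
    obtain ⟨y, hy, -, -, -, hM, -⟩ := h x hx
    obtain ⟨j, ⟨rfl, -⟩ | ⟨rfl, -⟩⟩ :=
      (cyclePairs_pairCode_iff hle (hlt x hx).le (hlt y hy).le).1 hM <;> exact ⟨_, hx⟩
  obtain ⟨j, hj, hmin⟩ := WellFounded.has_min (wellFounded_lt (α := Fin (k + 1)))
    {j | τ j ∈ c} hex
  have hprev : τ (j - 1) ∈ c := by
    obtain ⟨y, hy, z, hz, hyz, hMy, hMz⟩ := h _ hj
    rcases (cyclePairs_star_iff hτ hle j (hlt y hy).le).1 hMy with rfl | rfl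
    · rcases (cyclePairs_star_iff hτ hle j (hlt z hz).le).1 hMz with rfl | rfl
      · exact absurd rfl hyz
      · exact hz
    · exact hy
  refine hmin _ hprev ?_
  rw [Fin.sub_one_lt_iff, Fin.pos_iff_ne_zero]
  rintro rfl
  have : (0 : Fin (k + 1)) - 1 = Fin.last k :=
    sub_eq_iff_eq_add.2 (Fin.last_add_one k).symm
  rw [this, hlast] at hprev
  exact absurd (hlt _ hprev) (by norm_num)

end Cycle

/-! ### The search succeeds -/
/-- Candidates for paths on `k + 1` vertices using the edge from position `i` of the first path to the
end `k` of the path `0, …, k - 1`, written as decimal numbers with one digit for each label. Only those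
which repeat no label are used, and every path gives a constraint on the pairs in `M`. -/
def templates : ℕ → ℕ → List ℕ
  | 3, 1 =>
    [134, 123, 312, 135]
  | 4, 1 =>
    [32145, 32146, 1234, 1423, 4123, 32147]
  | 5, 1 =>
    [432156, 432157, 12345, 15234, 51234, 12346, 432106, 432158, 12347, 432107, 432015,
     43215, 15326, 432159, 12386, 12387, 12376, 12378, 12367, 12368, 15327]
  | 5, 2 =>
    [12576, 12567, 12365, 16523, 12345, 12534, 15234, 105234, 12586, 12587, 12578,
     12568, 12346, 12375, 17523, 432106, 12347, 432107, 12579, 12569, 12596, 12597,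
     12598, 12589, 12385, 18523]
  | 6, 1 =>
    [5432167, 5432168, 123456, 162345, 612345, 123457, 5432107, 123458, 5432169, 5432108,
     123487, 543216, 5432016, 5461237, 123497, 123498, 164327, 5436127, 5461238, 123459,
     123479, 123478, 123489, 164328, 5432109, 5436128, 321645, 125436, 5461239, 164329,
     5436129]
  | 6, 2 =>
    [5432687, 176234, 5432678, 123476, 126734, 186234, 123467, 123486, 126834, 123456,
     126345, 162345, 1062345, 123457, 123468, 5432107, 5432679, 5432697, 5432698, 5432689,
     123458, 5432108, 154326, 1054326, 5430126, 123496, 123469, 126934, 126437, 196234,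
     5432187, 126438, 123459, 5432109, 132645, 5432197, 5432198, 5432189, 5432178, 5432179,
     126439]
  | 7, 1 =>
    [1234756, 1237456, 65432178, 1234658, 1234589, 65712348, 1234567, 1723456, 7123456,
     1234568, 65432179, 1754328, 65432108, 1234657, 1234659, 6543217, 1732456, 4321756,
     65432017, 65471238, 1234569, 1754326, 65432109, 65712349, 65437128, 1754329, 1743285,
     1236547, 1234956, 1743256, 23710456, 1754238, 3217456, 65471239, 1743265, 1265437,
     1234598, 65437129, 65012348, 1234856, 1732548, 1743295, 1754239, 1745328, 1235498,
     1745329, 1732549, 65012349, 1235489, 1239845, 1238945, 1236548, 1236549]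
  | 7, 2 =>
    [1872345, 1234587, 1278345, 1278456, 1234578, 65432798, 1234756, 1854327, 65432789,
     1279456, 1234597, 1972345, 1273456, 1234567, 1723456, 10723456, 10543278, 65431278,
     1234568, 1279345, 1543278, 65432108, 1954327, 1274356, 1236547, 1234589, 1654327,
     1543279, 10654327, 65401279, 65430127, 65431279, 1234569, 65432198, 65432109, 1275438,
     65432189, 65438127, 1238547, 1239547, 1234657, 1432756, 1327456, 1234658, 1843275,
     34721056, 10432756, 1275436, 1234659, 1234856, 65439127, 1275439, 1234956, 65012348,
     1238456, 1239456, 1327549, 1234598, 1275489, 1275349]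
  | 7, 3 =>
    [1234587, 1873456, 1287345, 1237845, 65432178, 1234578, 1234589, 65432189, 1234597,
     1234579, 1973456, 65432179, 1654378, 1273456, 1237456, 1234567, 1297345, 1237945,
     21073456, 21054378, 1254378, 65412378, 1234568, 1237548, 65432198, 65432108, 65437128,
     1234658, 1234598, 1243756, 1265437, 1243789, 65412379, 65401237, 21065437, 1234657,
     1234569, 65432109, 2173456, 1237549, 1234897, 65437129, 65432018, 1732456, 1732548,
     1234659, 1654328, 1289734, 65481237, 65012348, 65432019, 73450128, 65491237, 1923456,
     1654329, 1457328, 1457329, 1732549, 1295437, 1542379, 1542378, 73216548, 65012349,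
     73450129, 73216549, 1284379, 1294378, 2154379, 1543289, 65123489, 65123498, 1854237,
     1954237, 1543298]
  | 8, 1 =>
    [12345967, 18324567, 12384567, 12567438, 12348567, 765403218, 67543218, 760123459,
     765423018, 18654327, 18654329, 12345768, 768123459, 54321867, 12376548, 765481239,
     765438129, 18543267, 18543276, 12347658, 765812349, 768125439, 12345769, 43218567,
     234581067, 32184567, 238104567, 18234567, 12345678, 765432189, 81234567, 45673218,
     12345679, 76543218, 765432109, 765432018, 18652349, 18432765, 12437658, 18432657,
     12347659, 12765438, 234810567, 56743218, 765012349, 18652347, 765812439, 12349567,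
     18542367, 18543296, 18564329, 765348129, 18432956, 12367548, 18326549, 765218349]
  | 8, 2 =>
    [12347659, 12843567, 19654328, 12348567, 760123459, 16754328, 19823456, 12893456,
     12894567, 12345698, 12345689, 12345867, 12354768, 765431289, 16543289, 12345769,
     765401289, 106543289, 14328567, 13284567, 15432867, 12865437, 12865439, 12345768,
     12367548, 12843659, 105432867, 348210567, 12854367, 12854376, 12347658, 14328956,
     12376548, 12865349, 18234567, 12834567, 12345678, 765439128, 108234567, 17654328,
     12345679, 19543286, 13285467, 765430128, 107654328, 765432109, 12854396, 104328567,
     345821067, 106754328, 761054328, 765123489, 765401328, 12349567, 765128439, 12346758,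
     12349658, 765014328, 12345967, 765340128, 765012349, 16582349, 12843956, 765143289,
     12346759, 43219567, 12395467]
  | 8, 3 =>
    [12675438, 12345769, 18326549, 12567438, 765012349, 21765438, 12438567, 12385467,
     12347658, 765438129, 21834567, 19834567, 12983456, 12389456, 12389567, 12345698,
     12345689, 12345867, 12349658, 17654329, 765432019, 17654389, 12654389, 765012389,
     210654389, 765410238, 12386547, 12386549, 12345768, 18324567, 458321067, 210543867,
     12347659, 12834567, 12384567, 12345678, 19234567, 12954386, 765218349, 210834567,
     12965438, 458320167, 12765438, 12345679, 765491238, 832176549, 765401238, 210765438,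
     765432109, 210675438, 12943856, 210567438, 834560129, 21543867, 12438659, 16542389,
     765124389, 12349567, 16754389, 12564389]
  | 9, 1 =>
    [197654238, 8765423019, 197652348, 196523487, 567843219, 591234678, 786543219,
     123876459, 8762345019, 196523478, 125678439, 491235678, 8765234019, 123487569,
     195423678, 123478659, 193245678, 123678549, 432197658, 432196578, 195432768,
     321945678, 194325678, 123876549, 8723456019, 678543219, 194235678, 8706543219,
     2391045678, 2654391078, 2391065478, 127865439, 123945678, 123485679, 345621978,
     8765043219, 432195678, 195432678, 123487659, 3265491078, 194562378, 2349105678,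
     654321978, 197654328, 123456879, 543219678, 2345691078, 196543278, 196543287,
     123458769, 2345910678, 195432876, 193265478, 123456978, 194328765, 8765432019,
     876543219, 912345678, 192345678, 123456789, 126543879, 196542387, 194532678,
     128765439, 193456278]
  | 9, 2 =>
    [123678549, 123485679, 123465879, 8765104329, 178654329, 8765401329, 8765340129,
     8710654329, 123548769, 129763458, 129543768, 1056432978, 123478659, 1069234578,
     8701654329, 1078654329, 132954678, 132945678, 129435678, 154923678, 8763450129,
     1056784329, 123487569, 1043295678, 143295678, 123487659, 167854329, 8760154329,
     8734560129, 123786549, 123495678, 1065432978, 165432978, 129765438, 123456879,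
     123654879, 129765348, 1054329678, 3456921078, 129654378, 129654387, 123458769,
     129653478, 8761054329, 123456978, 123459678, 3459210678, 129543876, 8765430129,
     1087654329, 1092345678, 187654329, 192345678, 129345678, 123456789, 123457869,
     123876549]
  | 9, 3 =>
    [123465879, 8765410239, 218765439, 127865439, 123478659, 8764501239, 216543978,
     8721065439, 8762105439, 187654239, 8701265439, 2107865439, 219345678, 4569320178,
     215439678, 124395678, 123954678, 193245678, 8760125439, 8745601239, 2106785439,
     193456278, 2106543978, 126543978, 123976548, 123456879, 2105439678, 4569321078,
     125439678, 123965487, 123458769, 124396578, 4593210678, 123487659, 5487601239,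
     125678439, 193452678, 123456978, 123459678, 8765401239, 2108765439, 2109345678,
     128765439, 129345678, 123945678, 123456789, 8765102439, 8710265439]
  | 9, 4 =>
    [123678549, 123786549, 8765102349, 8732106549, 132876549, 156782349, 128765349,
     321876549, 8765210349, 1032876549, 3201876549, 126534978, 187652349, 129437658,
     8756012349, 1032945678, 132945678, 187654329, 8701236549, 6587012349, 3210786549,
     3210678549, 3201945678, 194325678, 194328765, 192345678, 194532678, 182345679,
     3201654978, 321549678, 132549678, 321945678, 129435678, 3210654978, 123654978,
     123497658, 123456879, 156234978, 5694321078, 123549678, 123496578, 123458769,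
     8760123549, 8765012349, 3210876549, 3210945678, 123876549, 123945678, 123495678,
     123456789, 123687549, 127865349, 126587349, 154329678]
  | _, _ => []

theorem refuteAll_templates : ∀ k < 10, ∀ i < 5, 1 ≤ i → 2 * i + 1 ≤ k →
    refuteAll k i (templates k i) = true := by
  decide +kernel

/-! ### Labelling two paths -/

theorem forall_mem_of_isChain {α : Type*} {r : α → α → Prop} {P : α → Prop} {l : List α}
    (h : l.IsChain r) (hP : ∀ x y, r x y → P x ∧ P y) (hl : 2 ≤ l.length) : ∀ x ∈ l, P x := by
  intro x hx
  obtain ⟨i, hi, rfl⟩ := List.getElem_of_mem hx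
  by_cases hi' : i + 1 < l.length
  · exact (hP _ _ (h.getElem i hi')).1
  · obtain ⟨j, rfl⟩ : ∃ j, i = j + 1 := ⟨i - 1, by omega⟩
    exact (hP _ _ (h.getElem j hi)).2

theorem exists_length_lt_of_idxOf_le {V : Type*} [DecidableEq V] {R : V → V → Prop}
    (hR : ∀ u v, R u v → R v u) {p q : List V} {a b : V} (hp : p.Nodup) (hq : q.Nodup)
    (hpR : p.IsChain R) (hqR : q.IsChain R) (hlen : p.length = q.length)
    (ha : a ∈ p) (haq : a ∉ q) (hb : b ∈ q) (hbp : b ∉ p) (hab : R a b)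
    (hcard : p.length + (q.filter (· ∉ p)).length ≤ 10) (hi : 2 * p.idxOf a + 1 ≤ p.length) :
    ∃ l : List V, l.Nodup ∧ l.IsChain R ∧ (∀ x ∈ l, x ∈ p ∨ x ∈ q) ∧ p.length < l.length := by
  rcases Nat.eq_zero_or_pos (p.idxOf a) with h0 | h0
  · refine ⟨b :: p, List.nodup_cons.2 ⟨hbp, hp⟩, ?_, by simp_all, by simp⟩
    cases p with
    | nil => simp
    | cons c p =>
      have : c = a := by
        by_contra h
        rw [List.idxOf_cons_ne _ h] at h0
        omega
      subst this
      exact List.isChain_cons_cons.2 ⟨hR _ _ hab, hpR⟩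
  by_contra! hmax
  set k := p.length with hk
  set i₀ := p.idxOf a with hi₀
  have hi₀k : i₀ < k := List.idxOf_lt_length_of_mem ha
  set rest := (q.filter (· ∉ p)).erase b with hrest
  have hbf : b ∈ q.filter (· ∉ p) := by simp [hb, hbp]
  have hnf : (q.filter (· ∉ p)).Nodup := hq.filter _
  have hrlen : rest.length + 1 = (q.filter (· ∉ p)).length := by
    rw [hrest, List.length_erase_of_mem hbf]
    have := List.length_pos_of_mem hbf
    omega
  have hrmem (v) : v ∈ rest ↔ v ≠ b ∧ v ∈ q ∧ v ∉ p := by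
    rw [hrest, hnf.mem_erase_iff]; simp
  set full := p ++ b :: rest with hfull
  have hfmem (v) : v ∈ full ↔ v ∈ p ∨ v ∈ q := by
    rw [hfull, List.mem_append, List.mem_cons, hrmem]
    by_cases v = b <;> by_cases v ∈ p <;> simp_all
  have hfn : full.Nodup := by
    rw [hfull, List.nodup_append]
    refine ⟨hp, List.nodup_cons.2 ⟨by simp [hrmem], hnf.erase b⟩, ?_⟩
    rintro u hu _ hv rfl
    rw [List.mem_cons, hrmem] at hv
    rcases hv with rfl | hv
    · exact hbp hu
    · exact hv.2.2 hu
  set n := full.length with hn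
  have hnk : n = k + 1 + rest.length := by simp [hn, hfull, hk]; omega
  have hn10 : n ≤ 10 := by omega
  set φ : ℕ → V := fun i => full.getD i a with hφ
  have hφn (i) (h : i < n) : φ i = full[i] := List.getD_eq_getElem _ _ h
  have hφp (i) (h : i < k) : φ i = p[i] := by
    rw [hφn i (by omega)]; exact List.getElem_append_left h
  have hφk : φ k = b := by
    rw [hφn k (by omega)]; simp [hfull, hk]
  have hφi : φ i₀ = a := by rw [hφp i₀ hi₀k]; exact List.getElem_idxOf _
  have hφmem (i) (h : i < n) : φ i ∈ full := by rw [hφn i h]; exact List.getElem_mem _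
  have hφinj (i j) (h : i < n) (h' : j < n) (he : φ i = φ j) : i = j := by
    rw [hφn i h, hφn j h'] at he
    exact (hfn.getElem_inj_iff).1 he
  have hlabn (v) (h : v ∈ full) : full.idxOf v < n := List.idxOf_lt_length_of_mem h
  have hφlab (v) (h : v ∈ full) : φ (full.idxOf v) = v := by
    rw [hφn _ (hlabn v h)]; exact List.getElem_idxOf _
  set τ : Fin (k + 1) → ℕ := fun j => if h : j.val < k then full.idxOf (q[j.val]'(by omega)) else 10
    with hτ
  have hqf (v) (h : v ∈ q) : v ∈ full := (hfmem v).2 (.inr h)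
  have hτlt (j : Fin (k + 1)) (h : j.val < k) : τ j < n ∧ φ (τ j) = q[j.val] := by
    simp only [hτ, h, dite_true]
    exact ⟨hlabn _ (hqf _ (List.getElem_mem _)), hφlab _ (hqf _ (List.getElem_mem _))⟩
  have hτlast (j : Fin (k + 1)) (h : ¬ j.val < k) : τ j = 10 := by simp [hτ, h]
  have hτle (j) : τ j ≤ 10 := by
    by_cases h : j.val < k
    · have := (hτlt j h).1; omega
    · exact (hτlast j h).le
  have hτinj : τ.Injective := by
    intro i j h
    by_cases hi : i.val < k <;> by_cases hj : j.val < k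
    · have h1 := (hτlt i hi).2
      rw [h, (hτlt j hj).2, hq.getElem_inj_iff] at h1
      exact Fin.ext h1.symm
    · have := (hτlt i hi).1; have := hτlast j hj; omega
    · have := (hτlt j hj).1; have := hτlast i hi; omega
    · exact Fin.ext (by omega)
  set S := (List.range k).filter (φ · ∈ q) with hS
  have hSlen : S.length + (rest.length + 1) = k := by
    have h1 : S.length = (p.filter (· ∈ q)).length := by
      have : p = (List.range k).map φ := by
        refine List.ext_getElem (by simp [hk]) fun i h1 h2 => ?_
        simp [hφp i h1]
      conv_rhs => rw [this, List.filter_map, List.length_map]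
      rfl
    have h2 : (p.filter (· ∈ q)).length = (q.filter (· ∈ p)).length := by
      refine List.Perm.length_eq ((List.perm_ext_iff_of_nodup (hp.filter _) (hq.filter _)).2 ?_)
      simp [and_comm]
    have h3 := List.length_eq_length_filter_add (l := q) (fun v => decide (v ∈ p))
    have h4 : (q.filter (· ∉ p)).length = (q.filter (fun v => !decide (v ∈ p))).length := by simp
    omega
  have hlabels (x) : x ∈ labels k S ↔ ∃ j, x = τ j := by
    have h1 : x ∈ labels k S ↔ x = 10 ∨ (x < n ∧ φ x ∈ q) := by
      simp only [labels, List.mem_cons, List.mem_append, hS, List.mem_filter, List.mem_range,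
        List.mem_range'_1, decide_eq_true_eq, List.not_mem_nil, or_false]
      rw [← hS]
      constructor
      · rintro (rfl | h | h | h)
        · exact .inr ⟨by omega, by rw [hφk]; exact hb⟩
        · exact .inr ⟨by omega, h.2⟩
        · refine .inr ⟨by omega, ?_⟩
          have hx : x < n := by omega
          have : φ x ∈ rest := by
            rw [hφn x hx]
            simp only [hfull]
            rw [List.getElem_append_right (by omega), List.getElem_cons, dif_neg (by omega)]
            exact List.getElem_mem _
          exact ((hrmem _).1 this).2.1
        · exact .inl h
      · rintro (rfl | ⟨h, h'⟩)
        · simp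
        · rcases lt_trichotomy x k with h2 | rfl | h2
          · exact .inr (.inl ⟨h2, h'⟩)
          · exact .inl rfl
          · exact .inr (.inr (.inl (by omega)))
    rw [h1]
    constructor
    · rintro (rfl | ⟨h, h'⟩)
      · exact ⟨Fin.last k, (hτlast _ (by simp)).symm⟩
      · obtain ⟨j, hj, hj'⟩ := List.getElem_of_mem h'
        refine ⟨⟨j, by omega⟩, ?_⟩
        have h2 := hτlt ⟨j, by omega⟩ (by simpa using (by omega : j < k))
        exact hφinj _ _ h h2.1 (by rw [h2.2, ← hj'])
    · rintro ⟨j, rfl⟩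
      by_cases h : j.val < k
      · refine .inr ⟨(hτlt j h).1, ?_⟩
        rw [(hτlt j h).2]
        exact List.getElem_mem _
      · exact .inl (hτlast j h)
  have hstep (i : ℕ) (h : i + 1 < k) : R (φ i) (φ (i + 1)) := by
    rw [hφp i (by omega), hφp _ h]
    exact hpR.getElem i h
  have hcons (j : Fin (k + 1)) (h : τ j < 10) (h' : τ (j + 1) < 10) :
      τ j < n ∧ τ (j + 1) < n ∧ R (φ (τ j)) (φ (τ (j + 1))) := by
    have hj : j.val < k := by by_contra h1; have := hτlast j h1; omega
    have hj' : (j + 1).val < k := by by_contra h1; have := hτlast _ h1; omega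
    have hv : (j + 1).val = j.val + 1 := by
      rw [Fin.val_add_one, if_neg]
      rintro rfl
      simp at hj
    refine ⟨(hτlt j hj).1, (hτlt _ hj').1, ?_⟩
    rw [(hτlt j hj).2, (hτlt _ hj').2]
    simp only [hv]
    exact hqR.getElem j.val (by omega)
  refine refuteAll_sound (M := CyclePairs τ) (k := k) (i := i₀) (T := templates k i₀) (S := S)
    ?_ (by omega) ?_ ?_ (noClosedSet_cyclePairs hτinj hτle (hτlast _ (by simp))) ?_
    (refuteAll_templates k (by omega) i₀ (by omega) h0 hi)
  · have : S = ((List.range k).filter fun x => !(x == i₀)).filter (φ · ∈ q) := by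
      rw [hS, List.filter_filter]
      refine List.filter_congr fun x _ => ?_
      by_cases h : x = i₀
      · simp [h, hφi, haq]
      · simp [h]
    rw [this]
    exact List.filter_sublist
  · rintro e ⟨j, rfl⟩
    refine ⟨τ j, (hlabels _).2 ⟨j, rfl⟩, τ (j + 1), (hlabels _).2 ⟨_, rfl⟩, fun h => ?_, rfl⟩
    have h1 := hτinj h
    rw [add_eq_left, Fin.one_eq_zero_iff] at h1
    omega
  · intro x hx
    obtain ⟨j, rfl⟩ := (hlabels x).1 hx
    exact meetsTwice_cyclePairs hτinj hτle (by omega) j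
  · intro l hl hllen hl10 hchain
    have hchain' : l.IsChain fun x y => (x < n ∧ y < n) ∧ R (φ x) (φ y) := by
      rw [List.isChain_iff_getElem] at hchain ⊢
      intro i hi
      have hx := hl10 l[i] (List.getElem_mem _)
      have hy := hl10 l[i + 1] (List.getElem_mem _)
      have hc := hchain i hi
      generalize l[i] = x at hx hc ⊢
      generalize l[i + 1] = y at hy hc ⊢
      rcases hc with hc | hc
      · simp only [isBase, Bool.or_eq_true, Bool.and_eq_true, beq_iff_eq, Nat.blt_eq] at hc
        rcases hc with ((⟨rfl, h⟩ | ⟨rfl, h⟩) | ⟨rfl, rfl⟩) | ⟨rfl, rfl⟩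
        · exact ⟨by omega, hstep x h⟩
        · exact ⟨by omega, hR _ _ (hstep y h)⟩
        · rw [hφk, hφi]; exact ⟨by omega, hab⟩
        · rw [hφk, hφi]; exact ⟨by omega, hR _ _ hab⟩
      · obtain ⟨j, ⟨rfl, rfl⟩ | ⟨rfl, rfl⟩⟩ := (cyclePairs_pairCode_iff hτle hx.le hy.le).1 hc
        · obtain ⟨h1, h2, h3⟩ := hcons j hx hy
          exact ⟨⟨h1, h2⟩, h3⟩
        · obtain ⟨h1, h2, h3⟩ := hcons j hy hx
          exact ⟨⟨h2, h1⟩, hR _ _ h3⟩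
    have hln : ∀ x ∈ l, x < n :=
      forall_mem_of_isChain hchain' (fun x y h => h.1) (by omega)
    have := hmax (l.map φ) (hl.map_on fun x hx y hy h => hφinj x y (hln x hx) (hln y hy) h)
      ((List.isChain_map φ).2 (hchain'.imp fun _ _ h => h.2)) (fun v hv => ?_)
    · rw [List.length_map] at this; omega
    · obtain ⟨x, hx, rfl⟩ := List.mem_map.1 hv
      exact (hfmem _).1 (hφmem x (hln x hx))

theorem exists_length_lt {V : Type*} [DecidableEq V] {R : V → V → Prop}
    (hR : ∀ u v, R u v → R v u) {p q : List V} {a b : V} (hp : p.Nodup) (hq : q.Nodup)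
    (hpR : p.IsChain R) (hqR : q.IsChain R) (hlen : p.length = q.length)
    (ha : a ∈ p) (haq : a ∉ q) (hb : b ∈ q) (hbp : b ∉ p) (hab : R a b)
    (hcard : p.length + (q.filter (· ∉ p)).length ≤ 10) :
    ∃ l : List V, l.Nodup ∧ l.IsChain R ∧ (∀ x ∈ l, x ∈ p ∨ x ∈ q) ∧ p.length < l.length := by
  by_cases hi : 2 * p.idxOf a + 1 ≤ p.length
  · exact exists_length_lt_of_idxOf_le hR hp hq hpR hqR hlen ha haq hb hbp hab hcard hi
  · have hlt := List.idxOf_lt_length_of_mem ha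
    have hrev : p.reverse.idxOf a = p.length - 1 - p.idxOf a := by
      have h := (List.nodup_reverse.2 hp).idxOf_getElem (p.length - 1 - p.idxOf a)
        (by rw [List.length_reverse]; omega)
      rw [List.getElem_reverse] at h
      have h' : p.length - 1 - (p.length - 1 - p.idxOf a) = p.idxOf a := by omega
      simpa only [h', List.getElem_idxOf] using h
    simpa using exists_length_lt_of_idxOf_le hR (List.nodup_reverse.2 hp) hq
      (List.isChain_reverse.2 (hpR.imp hR)) hqR (by simpa using hlen)
      (List.mem_reverse.2 ha) haq hb (by simpa using hbp) hab (by simpa using hcard)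
      (by rw [hrev, List.length_reverse]; omega)

/-! ### Connections between the two paths -/

/-- A sequence starting in `A` and meeting `B` contains a segment from `A` to `B` with interior
disjoint from `A` and `B`. -/
theorem exists_isInfix_of_mem {V : Type*} {A B : V → Prop} {x : V} (l m : List V) (hx : A x)
    (hm : ∀ z ∈ m, ¬ A z ∧ ¬ B z) (hl : ∃ y ∈ l, B y) :
    ∃ a m' b, A a ∧ B b ∧ (∀ z ∈ m', ¬ A z ∧ ¬ B z) ∧
      (a :: (m' ++ [b])).IsInfix (x :: (m ++ l)) := by
  induction l generalizing x m with
  | nil => simp at hl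
  | cons z l ih =>
    by_cases hB : B z
    · exact ⟨x, m, z, hx, hB, hm, [], l, by simp⟩
    have hl' : ∃ y ∈ l, B y := by
      obtain ⟨y, hy, hy'⟩ := hl
      rcases List.mem_cons.1 hy with rfl | hy
      · exact absurd hy' hB
      · exact ⟨y, hy, hy'⟩
    by_cases hA : A z
    · obtain ⟨a, m', b, ha, hb, hm', h⟩ := ih [] hA (by simp) hl'
      exact ⟨a, m', b, ha, hb, hm', h.trans ⟨x :: m, [], by simp⟩⟩
    · simpa using ih (m ++ [z]) hx
        (by simpa [or_imp, forall_and, hA, hB] using fun z hz => hm z hz) hl'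

section Splice

variable {V : Type*} {G : SimpleGraph V} {a b : V}

/-- `u` and `v` are adjacent in the graph obtained by adding the edge `{a, b}` to `G`. -/
def AdjWith (G : SimpleGraph V) (a b u v : V) : Prop :=
  G.Adj u v ∨ (u = a ∧ v = b) ∨ (u = b ∧ v = a)

theorem AdjWith.symm {u v : V} (h : AdjWith G a b u v) : AdjWith G a b v u := by
  rcases h with h | h | h
  · exact .inl h.symm
  · exact .inr (.inr h.symm)
  · exact .inr (.inl h.symm)

theorem isChain_adj_or_exists_append {l : List V} (h : l.IsChain (AdjWith G a b)) :
    l.IsChain G.Adj ∨ ∃ s t, l = s ++ a :: b :: t ∨ l = s ++ b :: a :: t := by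
  induction l with
  | nil => simp
  | cons x l ih =>
    match l with
    | [] => simp
    | y :: l =>
      rw [List.isChain_cons_cons] at h ⊢
      rcases h.1 with h' | ⟨rfl, rfl⟩ | ⟨rfl, rfl⟩
      · rcases ih h.2 with h'' | ⟨s, t, h'' | h''⟩
        · exact .inl ⟨h', h''⟩
        · exact .inr ⟨x :: s, t, .inl (by rw [h'']; rfl)⟩
        · exact .inr ⟨x :: s, t, .inr (by rw [h'']; rfl)⟩
      · exact .inr ⟨[], l, .inl rfl⟩
      · exact .inr ⟨[], l, .inr rfl⟩

theorem isChain_adj_of_notMem {l : List V} (h : l.IsChain (AdjWith G a b))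
    (hl : a ∉ l ∨ b ∉ l) : l.IsChain G.Adj := by
  rcases isChain_adj_or_exists_append h with h | ⟨s, t, rfl | rfl⟩
  · exact h
  · simp at hl
  · simp at hl

theorem splice {s t m : List V} (hs : (s ++ [a]).IsChain G.Adj) (ht : (b :: t).IsChain G.Adj)
    (hm : (a :: (m ++ [b])).IsChain G.Adj) (hmn : m.Nodup) (hn : (s ++ a :: b :: t).Nodup)
    (hdisj : ∀ x ∈ s ++ a :: b :: t, x ∉ m) :
    ∃ l : List V, l.Nodup ∧ l.IsChain G.Adj ∧ (s ++ a :: b :: t).length ≤ l.length := by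
  refine ⟨s ++ a :: (m ++ b :: t), ?_, ?_, by simp⟩
  · have : (s ++ a :: (m ++ b :: t)).Perm (m ++ (s ++ a :: b :: t)) := by
      have h1 : s ++ a :: (m ++ b :: t) = (s ++ [a]) ++ (m ++ b :: t) := by simp
      have h2 : m ++ (s ++ a :: b :: t) = m ++ ((s ++ [a]) ++ b :: t) := by simp
      rw [h1, h2, ← List.append_assoc, ← List.append_assoc]
      exact List.perm_append_comm.append_right _
    rw [this.nodup_iff, List.nodup_append]
    refine ⟨hmn, hn, ?_⟩
    rintro x hx _ hy rfl
    exact hdisj x hy hx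
  · rw [List.isChain_split]
    refine ⟨hs, ?_⟩
    rw [← List.cons_append, List.isChain_split]
    exact ⟨by simpa using hm, ht⟩

theorem exists_isChain_adj {l m : List V} (hm : (a :: (m ++ [b])).IsChain G.Adj)
    (hmn : m.Nodup) (hl : l.IsChain (AdjWith G a b)) (hn : l.Nodup) (hdisj : ∀ x ∈ l, x ∉ m) :
    ∃ l' : List V, l'.Nodup ∧ l'.IsChain G.Adj ∧ l.length ≤ l'.length := by
  rcases isChain_adj_or_exists_append hl with h | ⟨s, t, rfl | rfl⟩
  · exact ⟨l, hn, h, le_rfl⟩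
  · rw [List.isChain_split, List.isChain_cons] at hl
    refine splice (isChain_adj_of_notMem hl.1 (.inr ?_))
      (isChain_adj_of_notMem hl.2.2 (.inl ?_)) hm hmn hn hdisj <;> grind
  · rw [List.isChain_split, List.isChain_cons] at hl
    refine splice (m := m.reverse) (isChain_adj_of_notMem hl.1 (.inl ?_))
      (isChain_adj_of_notMem hl.2.2 (.inr ?_)) ?_ (List.nodup_reverse.2 hmn) hn
      (by simpa using hdisj)
    · grind
    · grind
    · have := List.isChain_reverse.2 (hm.imp fun _ _ h => G.adj_symm h)
      simpa using this

end Splice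

theorem not_connected_induce {V : Type*} [Fintype V] (G : SimpleGraph V)
    (hcard : Fintype.card V ≤ 10) {p q : List V} (hp : p.Nodup) (hq : q.Nodup)
    (hpG : p.IsChain G.Adj) (hqG : q.IsChain G.Adj) (hlen : p.length = q.length)
    (hmax : ∀ l : List V, l.Nodup → l.IsChain G.Adj → l.length ≤ p.length)
    (hne : {x | x ∈ p} ≠ {x | x ∈ q}) :
    ¬ (G.induce ({x | x ∈ p} ∩ {x | x ∈ q})ᶜ).Connected := by
  classical
  have exists_mem {p q : List V} (hp : p.Nodup) (hlen : p.length = q.length)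
      (hne : {x | x ∈ p} ≠ {x | x ∈ q}) : ∃ a ∈ p, a ∉ q := by
    by_contra! h
    have := (hp.subperm h).perm_of_length_le hlen.ge
    exact hne (Set.ext fun x => this.mem_iff)
  obtain ⟨a₀, ha₀, ha₀q⟩ := exists_mem hp hlen hne
  obtain ⟨b₀, hb₀, hb₀p⟩ := exists_mem hq hlen.symm hne.symm
  intro hconn
  obtain ⟨W, hW⟩ := (hconn.preconnected ⟨a₀, fun h => ha₀q h.2⟩
    ⟨b₀, fun h => hb₀p h.1⟩).exists_isPath
  set w := W.support.map Subtype.val with hw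
  have hwn : w.Nodup := hW.support_nodup.map Subtype.val_injective
  have hwG : w.IsChain G.Adj := by
    rw [hw, List.isChain_map]
    exact W.isChain_adj_support
  have hwmem : ∀ x ∈ w, ¬ (x ∈ p ∧ x ∈ q) := by
    intro x hx
    obtain ⟨y, -, rfl⟩ := List.mem_map.1 hx
    exact y.2
  have hw' : w = a₀ :: W.support.tail.map Subtype.val := by
    rw [hw, ← W.cons_tail_support, List.map_cons, List.tail_cons]
  have hb₀w : b₀ ∈ W.support.tail.map Subtype.val := by
    have h : b₀ ∈ w := List.mem_map.2 ⟨_, W.end_mem_support, rfl⟩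
    rw [hw', List.mem_cons] at h
    exact h.resolve_left (by rintro rfl; exact hb₀p ha₀)
  obtain ⟨a, m, b, ha, hb, hm, hinf⟩ := exists_isInfix_of_mem (A := (· ∈ p)) (B := (· ∈ q))
    _ [] ha₀ (by simp) ⟨b₀, hb₀w, hb₀⟩
  rw [List.nil_append, ← hw'] at hinf
  have haq : a ∉ q := fun h => hwmem a (hinf.subset (by simp)) ⟨ha, h⟩
  have hbp : b ∉ p := fun h => hwmem b (hinf.subset (by simp)) ⟨h, hb⟩
  have hmn : m.Nodup := by
    have h := hwn.sublist hinf.sublist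
    rw [List.nodup_cons, List.nodup_append] at h
    exact h.2.1
  have hcard' : p.length + (q.filter (· ∉ p)).length ≤ 10 := by
    rw [← List.length_append]
    refine (List.Nodup.length_le_card ?_).trans hcard
    rw [List.nodup_append]
    refine ⟨hp, hq.filter _, ?_⟩
    rintro x hx _ hy rfl
    simp [hx] at hy
  obtain ⟨l, hl, hlR, hlmem, hlt⟩ := exists_length_lt (R := AdjWith G a b) (fun _ _ h => h.symm)
    hp hq (hpG.imp fun _ _ => .inl) (hqG.imp fun _ _ => .inl) hlen ha haq hb hbp
    (.inr (.inl ⟨rfl, rfl⟩)) hcard'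
  obtain ⟨l', hl', hl'G, hle⟩ := exists_isChain_adj (hwG.infix hinf) hmn hlR hl
    (fun x hx hxm => (hlmem x hx).elim (hm x hxm).1 (hm x hxm).2)
  have := hmax l' hl' hl'G
  omega

end LongestPathSeparator

/-- if `G` is a connected simple graph on at most 10 vertices and `P`, `Q`
are longest paths with different vertex sets, then `V(P) ∩ V(Q)` is a separator, i.e.
the subgraph induced on the complement of `V(P) ∩ V(Q)` is not connected. -/
theorem statement0 {V : Type*} [Fintype V] (G : SimpleGraph V)
    (hG : G.Connected) (hcard : Fintype.card V ≤ 10)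
    {u₁ v₁ u₂ v₂ : V} (P : G.Walk u₁ v₁) (Q : G.Walk u₂ v₂)
    (hP : IsLongestPath G P) (hQ : IsLongestPath G Q)
    (hne : {x | x ∈ P.support} ≠ {x | x ∈ Q.support}) :
    ¬ (G.induce ({x | x ∈ P.support} ∩ {x | x ∈ Q.support})ᶜ).Connected := by
  have hlen : P.length = Q.length := le_antisymm (hQ.2 P hP.1) (hP.2 Q hQ.1)
  refine LongestPathSeparator.not_connected_induce G hcard hP.1.support_nodup hQ.1.support_nodup
    P.isChain_adj_support Q.isChain_adj_support (by simp [hlen]) (fun l hl hlG => ?_) hne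
  rcases eq_or_ne l [] with rfl | hnil
  · simp
  · have h := hP.2 (Walk.ofSupport l hnil hlG) (by
      rw [Walk.isPath_def, Walk.support_ofSupport]
      exact hl)
    rw [Walk.length_ofSupport] at h
    rw [Walk.length_support]
    omega
end

section
/- There exists a connected simple graph G on exactly 11 vertices together with two longest paths P and Q in G such that V(P) ≠ V(Q), |V(P) ∩ V(Q)| = 9, and the subgraph of G induced on V(G) \ (V(P) ∩ V(Q)) is connected (so V(P) ∩ V(Q) is not a separator). -/
open SimpleGraph

/-- Depth-first search deciding whether the vertex `v` is the start of a walk of length `n` along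
the adjacency lists `nbr` whose later vertices are distinct and avoid `s`. -/
def hasExtension {V : Type*} [DecidableEq V] (nbr : V → List V) : ℕ → List V → V → Bool
  | 0, _, _ => true
  | n + 1, s, v => (nbr v).any fun w => !s.contains w && hasExtension nbr n (w :: s) w

theorem hasExtension_of_isPath {V : Type*} [DecidableEq V] {G : SimpleGraph V} {nbr : V → List V}
    (hnbr : ∀ u v, G.Adj u v → v ∈ nbr u) {u v : V} (p : G.Walk u v) (hp : p.IsPath)
    (s : List V) (hs : ∀ x ∈ p.support.tail, x ∉ s) (hu : u ∈ s) :
    hasExtension nbr p.length s u = true := by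
  induction p generalizing s with
  | nil => rfl
  | @cons u w _ h q ih =>
    rw [Walk.cons_isPath_iff] at hp
    simp only [Walk.support_cons, List.tail_cons] at hs
    simp only [Walk.length_cons, hasExtension, List.any_eq_true, Bool.and_eq_true]
    refine ⟨w, hnbr _ _ h, by simpa using hs w q.start_mem_support, ih hp.1 _ ?_ (by simp)⟩
    intro x hx hxs
    rcases List.mem_cons.1 hxs with rfl | hxs
    · have hnd := hp.1.support_nodup
      rw [← Walk.cons_tail_support, List.nodup_cons] at hnd
      exact hnd.1 hx
    · exact hs x (List.mem_of_mem_tail hx) hxs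

/-- Adjacency lists of the Petersen graph minus a vertex, with pendant vertices `0` and `9`
attached to two of the neighbours of the deleted vertex. -/
def petersenNeighbors : Fin 11 → List (Fin 11) :=
  ![[1], [0, 2, 10], [1, 3, 6], [2, 4, 8], [3, 5, 10], [4, 6], [5, 7, 2], [6, 8, 10], [7, 9, 3],
    [8], [4, 1, 7]]

/-- The Petersen graph minus a vertex, with pendant vertices `0` and `9` attached to two of the
neighbours of the deleted vertex. -/
def pendantPetersen : SimpleGraph (Fin 11) where
  Adj u v := v ∈ petersenNeighbors u
  symm := ⟨by decide⟩
  loopless := ⟨by decide⟩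

instance : DecidableRel pendantPetersen.Adj :=
  fun u v => inferInstanceAs (Decidable (v ∈ petersenNeighbors u))

theorem pendantPetersen_length_le {u v : Fin 11} (p : pendantPetersen.Walk u v) (hp : p.IsPath) :
    p.length ≤ 9 := by
  by_contra! h
  have hlen : p.length = 10 := by
    have := hp.length_lt
    rw [Fintype.card_fin] at this
    omega
  have hnot : ∀ w, hasExtension petersenNeighbors 10 [w] w = false := by decide +kernel
  have hext := hasExtension_of_isPath (nbr := petersenNeighbors) (fun _ _ h => h) p hp [u] (by
    have hnd := hp.support_nodup
    rw [← Walk.cons_tail_support, List.nodup_cons] at hnd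
    intro x hx hxu
    exact hnd.1 (List.mem_singleton.1 hxu ▸ hx)) (by simp)
  rw [hlen, hnot] at hext
  exact Bool.false_ne_true hext

/-- A longest path of `pendantPetersen` that misses the vertex `10`. -/
def pathAvoidingTen : pendantPetersen.Walk 0 9 :=
  .cons (v := 1) (by decide) <| .cons (v := 2) (by decide) <| .cons (v := 3) (by decide) <|
  .cons (v := 4) (by decide) <| .cons (v := 5) (by decide) <| .cons (v := 6) (by decide) <|
  .cons (v := 7) (by decide) <| .cons (v := 8) (by decide) <| .cons (v := 9) (by decide) .nil

/-- A longest path of `pendantPetersen` that misses the vertex `7`. -/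
def pathAvoidingSeven : pendantPetersen.Walk 9 0 :=
  .cons (v := 8) (by decide) <| .cons (v := 3) (by decide) <| .cons (v := 2) (by decide) <|
  .cons (v := 6) (by decide) <| .cons (v := 5) (by decide) <| .cons (v := 4) (by decide) <|
  .cons (v := 10) (by decide) <| .cons (v := 1) (by decide) <| .cons (v := 0) (by decide) .nil

theorem mem_support_pathAvoidingTen (x : Fin 11) : x ∈ pathAvoidingTen.support ↔ x ≠ 10 := by
  revert x; decide

theorem mem_support_pathAvoidingSeven (x : Fin 11) : x ∈ pathAvoidingSeven.support ↔ x ≠ 7 := by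
  revert x; decide

theorem pendantPetersen_connected : pendantPetersen.Connected := by
  rw [connected_iff_exists_forall_reachable]
  refine ⟨0, fun x => ?_⟩
  by_cases hx : x = 10
  · subst hx
    exact (pathAvoidingSeven.dropUntil 10 (by decide)).reachable.symm
  · exact (pathAvoidingTen.takeUntil x ((mem_support_pathAvoidingTen x).2 hx)).reachable

/-- there is a connected simple graph on exactly 11 vertices with two
longest paths `P`, `Q` such that `V(P) ≠ V(Q)`, `|V(P) ∩ V(Q)| = 9`, and the subgraph
induced on the complement of `V(P) ∩ V(Q)` is connected. -/
theorem statement1 :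
    ∃ (G : SimpleGraph (Fin 11)) (u₁ v₁ u₂ v₂ : Fin 11)
      (P : G.Walk u₁ v₁) (Q : G.Walk u₂ v₂),
      G.Connected ∧ IsLongestPath G P ∧ IsLongestPath G Q ∧
      {x | x ∈ P.support} ≠ {x | x ∈ Q.support} ∧
      ({x | x ∈ P.support} ∩ {x | x ∈ Q.support}).ncard = 9 ∧
      (G.induce ({x | x ∈ P.support} ∩ {x | x ∈ Q.support})ᶜ).Connected := by
  have hinter : ({x | x ∈ pathAvoidingTen.support} ∩ {x | x ∈ pathAvoidingSeven.support})
      = ({10, 7} : Set (Fin 11))ᶜ := by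
    ext x
    simp [mem_support_pathAvoidingTen, mem_support_pathAvoidingSeven]
  refine ⟨pendantPetersen, 0, 9, 9, 0, pathAvoidingTen, pathAvoidingSeven,
    pendantPetersen_connected,
    ⟨(Walk.isPath_def _).2 (by decide), fun R hR => pendantPetersen_length_le R hR⟩,
    ⟨(Walk.isPath_def _).2 (by decide), fun R hR => pendantPetersen_length_le R hR⟩, ?_, ?_, ?_⟩
  · intro h
    have h7 : (7 : Fin 11) ∈ {x | x ∈ pathAvoidingTen.support} := by
      simp [mem_support_pathAvoidingTen]
    rw [h] at h7
    exact (mem_support_pathAvoidingSeven 7).1 h7 rfl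
  · rw [hinter, Set.ncard_compl, Set.ncard_pair (by decide), Nat.card_eq_fintype_card,
      Fintype.card_fin]
  · rw [hinter, compl_compl]
    exact induce_pair_connected_of_adj (by decide)
end

section
/- The least natural number n for which there exists a connected simple graph G on n vertices having two longest paths P and Q with V(P) ≠ V(Q) such that the subgraph of G induced on V(G) \ (V(P) ∩ V(Q)) is connected is n = 11. -/
open SimpleGraph

theorem IsLongestPath.length_support_eq {V : Type*} {G : SimpleGraph V} {a b c d : V}
    {P : G.Walk a b} {Q : G.Walk c d} (hP : IsLongestPath G P) (hQ : IsLongestPath G Q) :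
    P.support.length = Q.support.length := by
  rw [Walk.length_support, Walk.length_support, le_antisymm (hQ.2 P hP.1) (hP.2 Q hQ.1)]

theorem IsLongestPath.length_le {V : Type*} {G : SimpleGraph V} {a b : V} {P : G.Walk a b}
    (hP : IsLongestPath G P) {l : List V} (hl : l.IsChain G.Adj) (hn : l.Nodup) :
    l.length ≤ P.support.length := by
  by_cases h : l = []
  · simp [h]
  have hs := Walk.support_ofSupport h hl
  have := hP.2 (Walk.ofSupport l h hl) (Walk.isPath_def _ |>.2 (by rwa [hs]))
  rw [← hs, Walk.length_support, Walk.length_support]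
  exact Nat.succ_le_succ this

namespace LongestPathSearch

/-- `force n f` is `f n`; the recursor makes the kernel evaluate `n` to a numeral first. -/
def force {α : Type} (n : ℕ) (f : ℕ → α) : α :=
  Nat.rec (f 0) (fun i _ => f (Nat.succ i)) n

/-- Does `f` hold at some set bit of `c`? At most `n` bits are inspected. -/
def anyBit (n : ℕ) : ℕ → (ℕ → Bool) → Bool :=
  Nat.rec (fun _ _ => false)
    (fun _ ih c f => bif Nat.beq c 0 then false else
      force (Nat.log2 c) fun w =>
        bif f w then true else ih (Nat.xor c (Nat.shiftLeft 1 w)) f) n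

/-- Does `f` hold at all set bits of `c`? The answer is `false` if there are more than `n` bits. -/
def allBit (n : ℕ) : ℕ → (ℕ → Bool) → Bool :=
  Nat.rec (fun c _ => Nat.beq c 0)
    (fun _ ih c f => bif Nat.beq c 0 then true else
      force (Nat.log2 c) fun w =>
        bif f w then ih (Nat.xor c (Nat.shiftLeft 1 w)) f else false) n

/-- Position of the pair `(i, j)` in an adjacency matrix stored as a natural number. -/
def pos (i j : ℕ) : ℕ := Nat.add (Nat.mul 16 i) j

def row (A i : ℕ) : ℕ := Nat.shiftRight A (Nat.mul 16 i)

def edge (i j : ℕ) : ℕ := Nat.lor (Nat.shiftLeft 1 (pos i j)) (Nat.shiftLeft 1 (pos j i))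

def addEdge (A i j : ℕ) : ℕ := Nat.lor A (edge i j)

def hasEdge (A i j : ℕ) : Bool := Nat.beq (Nat.mod (Nat.shiftRight A (pos i j)) 2) 1

/-- Can a path ending in `v` be prolonged beyond `v` by `n` vertices from the set `fr`? -/
def extendEnd (A n : ℕ) : ℕ → ℕ → Bool :=
  Nat.rec (fun _ _ => true)
    (fun _ ih v fr => anyBit 16 (Nat.land (row A v) fr) fun w =>
      force (Nat.xor fr (Nat.shiftLeft 1 w)) fun fr' => ih w fr') n

/-- Can a path from `a` to `b` be prolonged on both sides by `n` vertices from the set `fr`? -/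
def extendBoth (A n : ℕ) : ℕ → ℕ → ℕ → Bool :=
  Nat.rec (fun _ _ _ => true)
    (fun n ih a b fr => bif extendEnd A (Nat.succ n) b fr then true else
      anyBit 16 (Nat.land (row A a) fr) fun w =>
        force (Nat.xor fr (Nat.shiftLeft 1 w)) fun fr' => ih w b fr') n

/-- Is there a path with `k + 1` vertices? -/
def hasLong (A k : ℕ) : Bool :=
  anyBit 16 1023 fun i => extendEnd A k i (Nat.xor 1023 (Nat.shiftLeft 1 i))

/-- Is there a path with `k + 1` vertices through the edge `ij`? -/
def hasLongThrough (A k i j : ℕ) : Bool :=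
  extendBoth A (Nat.sub k 1) i j
    (Nat.xor (Nat.xor 1023 (Nat.shiftLeft 1 i)) (Nat.shiftLeft 1 j))

/-- Delete from the matrix `al` those pairs of the list `l` which, added to the graph `A`,
create a path with `k + 1` vertices. -/
def refine (A k : ℕ) (l : List (ℕ × ℕ)) : ℕ → (ℕ → Bool) → Bool :=
  List.rec (fun al K => K al)
    (fun e _ ih al K =>
      bif hasEdge al e.1 e.2 then
        bif hasEdge A e.1 e.2 then ih al K else
          force (addEdge A e.1 e.2) fun A' =>
            bif hasLongThrough A' k e.1 e.2 then
              force (Nat.xor al (edge e.1 e.2)) fun al' => ih al' K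
            else ih al K
      else ih al K) l

/-- For each pair of the list `l`, the refinement of `al` after adding that pair to `A`. -/
def table (A k al : ℕ) (l : List (ℕ × ℕ)) : (List ℕ → Bool) → Bool :=
  List.rec (fun K => K [])
    (fun e l ih K =>
      bif hasEdge al e.1 e.2 then
        bif hasEdge A e.1 e.2 then ih fun t => K (al :: t) else
          force (addEdge A e.1 e.2) fun A' =>
            refine A' k l al fun al' => ih fun t => K (al' :: t)
      else ih fun t => K (0 :: t)) l

def pairs : List (ℕ × ℕ) :=
  (List.range 10).flatMap fun j => (List.range j).map fun i => (i, j)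

def pairIndex (i j : ℕ) : ℕ :=
  bif Nat.ble i j then Nat.add (Nat.div (Nat.mul j (Nat.sub j 1)) 2) i
  else Nat.add (Nat.div (Nat.mul i (Nat.sub i 1)) 2) j

/-- Prolong the second path beyond its end `a` by one vertex `w` of `fr` in all ways compatible
with the matrix `al` of possible edges. -/
def step (t : List ℕ) (A al a fr : ℕ) (K : ℕ → ℕ → ℕ → ℕ → Bool) : Bool :=
  allBit 16 (Nat.land (row al a) fr) fun w =>
    force (addEdge A a w) fun A' =>
      force (Nat.land al (t.getD (pairIndex a w) 0)) fun al' =>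
        bif Nat.beq (Nat.land A' al') A' then
          force (Nat.xor fr (Nat.shiftLeft 1 w)) fun fr' => K A' al' w fr'
        else true

/-- All prolongations by `r` vertices at the end `a` create a path with `k + 1` vertices. -/
def growEnd (k : ℕ) (t : List ℕ) (r : ℕ) : ℕ → ℕ → ℕ → ℕ → Bool :=
  Nat.rec (fun A _ _ _ => hasLong A k)
    (fun _ ih A al a fr => step t A al a fr ih) r

/-- All prolongations by `r` vertices at the two ends `a` and `b`, at least half of them at `a`,
create a path with `k + 1` vertices. -/
def growBoth (k : ℕ) (t : List ℕ) (n : ℕ) : ℕ → ℕ → ℕ → ℕ → ℕ → ℕ → Bool :=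
  Nat.rec (fun _ _ _ _ _ _ => false)
    (fun _ ih r A al a b fr => bif Nat.beq r 0 then hasLong A k else
      step t A al a fr fun A' al' w fr' =>
        bif growEnd k t (Nat.sub r 1) A' al' w fr' then
          bif Nat.beq r 1 then true else
            step t A' al' b fr' fun A'' al'' z fr'' => ih (Nat.sub r 2) A'' al'' w z fr''
        else false) n

def pathGraph (n : ℕ) : ℕ := Nat.rec 0 (fun i A => addEdge A i (Nat.succ i)) n

def search (k x : ℕ) : Bool :=
  force (addEdge (pathGraph (Nat.sub k 1)) x k) fun A =>
    bif hasLong A k then true else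
      refine A k pairs (Nat.sub (Nat.pow 2 160) 1) fun al => table A k al pairs fun t =>
        growBoth k t k (Nat.sub k 1) A al k k
          (Nat.xor (Nat.xor 1023 (Nat.shiftLeft 1 x)) (Nat.shiftLeft 1 k))

theorem force_eq {α : Type} (n : ℕ) (f : ℕ → α) : force n f = f n := by
  cases n <;> rfl

theorem testBit_xor_shiftLeft (c w j : ℕ) :
    (Nat.xor c (Nat.shiftLeft 1 w)).testBit j = true ↔
      (c.testBit j = true ↔ j ≠ w) := by
  change (c ^^^ (1 <<< w)).testBit j = true ↔ _
  rw [Nat.one_shiftLeft, Nat.testBit_xor, Nat.testBit_two_pow]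
  by_cases h : w = j
  · subst h; cases c.testBit w <;> simp
  · have h' : j ≠ w := Ne.symm h
    cases c.testBit j <;> simp [h, h']

theorem anyBit_sound {n : ℕ} {c : ℕ} {f : ℕ → Bool} (h : anyBit n c f = true) :
    ∃ j, c.testBit j = true ∧ f j = true := by
  induction n generalizing c with
  | zero => exact absurd h Bool.false_ne_true
  | succ n ih =>
    change (bif Nat.beq c 0 then false else force (Nat.log2 c) fun w =>
      bif f w then true else anyBit n (Nat.xor c (Nat.shiftLeft 1 w)) f) = true at h
    rw [force_eq] at h
    by_cases hc : c = 0
    · subst hc; exact absurd h Bool.false_ne_true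
    have hc' : Nat.beq c 0 = false := by
      rw [← Bool.not_eq_true, Nat.beq_eq]; exact hc
    have hl : c.testBit (Nat.log2 c) = true := Nat.testBit_log2 hc
    rw [hc', cond_false] at h
    cases hf : f (Nat.log2 c) with
    | true => exact ⟨_, hl, hf⟩
    | false =>
      rw [hf, cond_false] at h
      obtain ⟨j, hj, hfj⟩ := ih h
      rw [testBit_xor_shiftLeft] at hj
      refine ⟨j, hj.2 ?_, hfj⟩
      rintro rfl
      simp [hf] at hfj

theorem allBit_sound {n : ℕ} {c : ℕ} {f : ℕ → Bool} (h : allBit n c f = true) {j : ℕ}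
    (hj : c.testBit j = true) : f j = true := by
  induction n generalizing c with
  | zero =>
    have : c = 0 := Nat.eq_of_beq_eq_true h
    simp [this] at hj
  | succ n ih =>
    change (bif Nat.beq c 0 then true else force (Nat.log2 c) fun w =>
      bif f w then allBit n (Nat.xor c (Nat.shiftLeft 1 w)) f else false) = true at h
    rw [force_eq] at h
    cases hc : Nat.beq c 0 with
    | true =>
      have : c = 0 := Nat.eq_of_beq_eq_true hc
      simp [this] at hj
    | false =>
      cases hf : f (Nat.log2 c) with
      | false => simp [hc, hf] at h
      | true =>
        simp only [hc, hf, cond_false, cond_true] at h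
        by_cases hw : j = Nat.log2 c
        · rw [hw]; exact hf
        · exact ih h ((testBit_xor_shiftLeft _ _ _).2 ⟨fun _ => hw, fun _ => hj⟩)

/-- All edges of the matrix `A` are pairs in the relation `R`. -/
def Below (A : ℕ) (R : ℕ → ℕ → Prop) : Prop :=
  ∀ i j, j < 16 → A.testBit (pos i j) = true → R i j

/-- All pairs in the relation `R` are edges of the matrix `A`. -/
def Above (A : ℕ) (R : ℕ → ℕ → Prop) : Prop :=
  ∀ i j, R i j → A.testBit (pos i j) = true

theorem testBit_row (A i j : ℕ) : (row A i).testBit j = A.testBit (pos i j) :=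
  Nat.testBit_shiftRight ..

theorem testBit_row_land (A i j fr : ℕ) : (Nat.land (row A i) fr).testBit j = true ↔
    A.testBit (pos i j) = true ∧ fr.testBit j = true := by
  rw [← testBit_row]
  change (row A i &&& fr).testBit j = true ↔ _
  rw [Nat.testBit_and, Bool.and_eq_true]

theorem pos_inj {i j i' j' : ℕ} (hj : j < 16) (hj' : j' < 16) (h : pos i j = pos i' j') :
    i = i' ∧ j = j' := by
  change 16 * i + j = 16 * i' + j' at h
  omega

theorem testBit_edge {i j p q : ℕ} (hi : i < 16) (hj : j < 16) (hq : q < 16) :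
    (edge i j).testBit (pos p q) = true ↔ (p = i ∧ q = j) ∨ (p = j ∧ q = i) := by
  change ((1 <<< pos i j) ||| (1 <<< pos j i)).testBit (pos p q) = true ↔ _
  rw [Nat.one_shiftLeft, Nat.one_shiftLeft, Nat.testBit_or, Nat.testBit_two_pow,
    Nat.testBit_two_pow, Bool.or_eq_true, decide_eq_true_iff, decide_eq_true_iff]
  constructor
  · rintro (h | h)
    · obtain ⟨rfl, rfl⟩ := pos_inj hj hq h; exact .inl ⟨rfl, rfl⟩
    · obtain ⟨rfl, rfl⟩ := pos_inj hi hq h; exact .inr ⟨rfl, rfl⟩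
  · rintro (⟨rfl, rfl⟩ | ⟨rfl, rfl⟩)
    · exact .inl rfl
    · exact .inr rfl

theorem hasEdge_iff (A i j : ℕ) : hasEdge A i j = true ↔ A.testBit (pos i j) = true := by
  change Nat.beq ((A >>> pos i j) % 2) 1 = true ↔ _
  rw [Nat.beq_eq, Nat.testBit_eq_decide_div_mod_eq, Nat.shiftRight_eq_div_pow, decide_eq_true_iff]

/-- A symmetric irreflexive relation on the numbers below `10` without paths on more than `k`
vertices. -/
structure Bounded (R : ℕ → ℕ → Prop) (k : ℕ) : Prop where
  symm : ∀ {i j}, R i j → R j i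
  lt : ∀ {i j}, R i j → i < 10
  ne : ∀ {i j}, R i j → i ≠ j
  le : ∀ l : List ℕ, l.IsChain R → l.Nodup → l.length ≤ k

variable {R : ℕ → ℕ → Prop} {k : ℕ}

theorem Below.addEdge {A i j : ℕ} (hR : Bounded R k) (hA : Below A R) (h : R i j) :
    Below (addEdge A i j) R := by
  intro p q hq hpq
  change (A ||| edge i j).testBit (pos p q) = true at hpq
  rw [Nat.testBit_or, Bool.or_eq_true] at hpq
  have hi := hR.lt h
  have hj := hR.lt (hR.symm h)
  rcases hpq with hpq | hpq
  · exact hA p q hq hpq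
  · rcases (testBit_edge (by omega) (by omega) hq).1 hpq with ⟨rfl, rfl⟩ | ⟨rfl, rfl⟩
    · exact h
    · exact hR.symm h

theorem Above.land {A B : ℕ} (hA : Above A R) (hB : Above B R) : Above (Nat.land A B) R := by
  intro i j h
  change (A &&& B).testBit _ = true
  rw [Nat.testBit_and, hA i j h, hB i j h]; rfl

theorem Above.clear {al i j : ℕ} (hR : Bounded R k) (h : Above al R) (hi : i < 16) (hj : j < 16)
    (hij : ¬ R i j) : Above (Nat.xor al (edge i j)) R := by
  intro p q hpq
  change (al ^^^ edge i j).testBit _ = true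
  have hq := hR.lt (hR.symm hpq)
  have : ¬ (edge i j).testBit (pos p q) = true := by
    rw [testBit_edge hi hj (by omega)]
    rintro (⟨rfl, rfl⟩ | ⟨rfl, rfl⟩)
    · exact hij hpq
    · exact hij (hR.symm hpq)
  rw [Nat.testBit_xor, h p q hpq, Bool.eq_false_iff.2 this]; rfl

theorem land_eq_of_below_of_above {A al : ℕ} (hA : Below A R) (h : Above al R) :
    Nat.land A al = A := by
  change A &&& al = A
  refine Nat.eq_of_testBit_eq fun n => ?_
  rw [Nat.testBit_and]
  cases hn : A.testBit n with
  | false => rfl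
  | true =>
    have e : n = pos (n / 16) (n % 16) := (Nat.div_add_mod n 16).symm
    rw [e] at hn ⊢
    rw [h _ _ (hA _ _ (Nat.mod_lt _ (by norm_num)) hn)]; rfl

/-- `fr` is a set of numbers below `16` outside the list `l`. -/
def Free (fr : ℕ) (l : List ℕ) : Prop := ∀ u, fr.testBit u = true → u < 16 ∧ u ∉ l

theorem Free.cons {fr w : ℕ} {l : List ℕ} (h : Free fr l) (hw : fr.testBit w = true) :
    Free (Nat.xor fr (Nat.shiftLeft 1 w)) (w :: l) := by
  intro u hu
  rw [testBit_xor_shiftLeft] at hu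
  by_cases huw : u = w
  · subst huw; exact absurd rfl (hu.1 hw)
  · have := h u (hu.2 huw)
    simp [huw, this]

theorem Free.reverse {fr : ℕ} {l : List ℕ} (h : Free fr l) : Free fr l.reverse :=
  fun u hu => by simpa using h u hu

theorem free_all : Free 1023 [] := by
  intro u hu
  refine ⟨?_, List.not_mem_nil⟩
  rw [show 1023 = 2 ^ 10 - 1 from rfl, Nat.testBit_two_pow_sub_one, decide_eq_true_iff] at hu
  omega

theorem extendEnd_sound {A n v fr : ℕ} {l : List ℕ} (hR : Bounded R k) (hA : Below A R)
    (hl : (v :: l).IsChain R) (hn : (v :: l).Nodup) (hfr : Free fr (v :: l))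
    (h : extendEnd A n v fr = true) : n + (v :: l).length ≤ k := by
  induction n generalizing v l fr with
  | zero => simpa using hR.le _ hl hn
  | succ n ih =>
    change (anyBit 16 (Nat.land (row A v) fr) fun w =>
      force (Nat.xor fr (Nat.shiftLeft 1 w)) fun fr' => extendEnd A n w fr') = true at h
    obtain ⟨w, hw, h⟩ := anyBit_sound h
    rw [force_eq] at h
    rw [testBit_row_land] at hw
    obtain ⟨h16, hmem⟩ := hfr w hw.2
    have := ih (List.isChain_cons_cons.2 ⟨hR.symm (hA _ _ h16 hw.1), hl⟩)
      (List.nodup_cons.2 ⟨hmem, hn⟩) (hfr.cons hw.2) h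
    simp only [List.length_cons] at this ⊢
    omega

theorem isChain_reverse {l : List ℕ} (hR : Bounded R k) (hl : l.IsChain R) :
    l.reverse.IsChain R :=
  List.isChain_reverse.2 (hl.imp fun _ _ h => hR.symm h)

theorem extendBoth_sound {A n a b fr : ℕ} {l l' : List ℕ} (hR : Bounded R k) (hA : Below A R)
    (hl : (a :: l).IsChain R) (hn : (a :: l).Nodup) (hrev : (a :: l).reverse = b :: l')
    (hfr : Free fr (a :: l)) (h : extendBoth A n a b fr = true) :
    n + (a :: l).length ≤ k := by
  induction n generalizing a l l' fr with
  | zero => simpa using hR.le _ hl hn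
  | succ n ih =>
    change (bif extendEnd A (Nat.succ n) b fr then true else
      anyBit 16 (Nat.land (row A a) fr) fun w =>
        force (Nat.xor fr (Nat.shiftLeft 1 w)) fun fr' => extendBoth A n w b fr') = true at h
    cases he : extendEnd A (Nat.succ n) b fr with
    | true =>
      have := extendEnd_sound hR hA (hrev ▸ isChain_reverse hR hl)
        (hrev ▸ List.nodup_reverse.2 hn) (hrev ▸ hfr.reverse) he
      rwa [← hrev, List.length_reverse] at this
    | false =>
      rw [he, cond_false] at h
      obtain ⟨w, hw, h⟩ := anyBit_sound h
      rw [force_eq] at h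
      rw [testBit_row_land] at hw
      obtain ⟨h16, hmem⟩ := hfr w hw.2
      have := ih (List.isChain_cons_cons.2 ⟨hR.symm (hA _ _ h16 hw.1), hl⟩)
        (List.nodup_cons.2 ⟨hmem, hn⟩) (l' := l' ++ [w])
        (by rw [List.reverse_cons, hrev]; rfl) (hfr.cons hw.2) h
      simp only [List.length_cons] at this ⊢
      omega

theorem hasLong_eq_false {A : ℕ} (hR : Bounded R k) (hA : Below A R) : hasLong A k = false := by
  rw [← Bool.not_eq_true]
  intro h
  obtain ⟨i, hi, h⟩ := anyBit_sound h
  have := extendEnd_sound (l := []) hR hA (List.isChain_singleton _) (List.nodup_singleton _)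
    (free_all.cons hi) h
  simp at this

theorem not_rel_of_hasLongThrough {A i j : ℕ} (hR : Bounded R k) (hA : Below A R)
    (h : hasLongThrough (addEdge A i j) k i j = true) : ¬ R i j := by
  intro hij
  have bit : ∀ {u}, u < 10 → (1023 : ℕ).testBit u = true := fun hu => by
    rw [show 1023 = 2 ^ 10 - 1 from rfl, Nat.testBit_two_pow_sub_one, decide_eq_true_iff]
    exact hu
  have hf : Free _ [j, i] := (free_all.cons (bit (hR.lt hij))).cons
    ((testBit_xor_shiftLeft _ _ _).2
      ⟨fun _ => (hR.ne hij).symm, fun _ => bit (hR.lt (hR.symm hij))⟩)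
  have := extendBoth_sound (l := [j]) (l' := [i]) hR (hA.addEdge hR hij)
    (by simpa using hij) (by simpa using hR.ne hij) rfl hf.reverse h
  have h2 : Nat.sub k 1 = k - 1 := rfl
  simp only [List.length_cons, List.length_nil, h2] at this
  omega

theorem refine_sound {A al : ℕ} {l : List (ℕ × ℕ)} {K : ℕ → Bool} (hR : Bounded R k)
    (hal : Below A R → Above al R) (hl : ∀ e ∈ l, e.1 < 16 ∧ e.2 < 16)
    (h : refine A k l al K = true) : ∃ al', (Below A R → Above al' R) ∧ K al' = true := by
  induction l generalizing al with
  | nil => exact ⟨al, hal, h⟩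
  | cons e l ih =>
    have hl' : ∀ e ∈ l, e.1 < 16 ∧ e.2 < 16 := fun e he => hl e (List.mem_cons_of_mem _ he)
    obtain ⟨h1, h2⟩ := hl e List.mem_cons_self
    change (bif hasEdge al e.1 e.2 then
        bif hasEdge A e.1 e.2 then refine A k l al K else
          force (addEdge A e.1 e.2) fun A' =>
            bif hasLongThrough A' k e.1 e.2 then
              force (Nat.xor al (edge e.1 e.2)) fun al' => refine A k l al' K
            else refine A k l al K
      else refine A k l al K) = true at h
    simp only [force_eq] at h
    cases e1 : hasEdge al e.1 e.2 <;> simp only [e1, cond_true, cond_false] at h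
    · exact ih hal hl' h
    cases e2 : hasEdge A e.1 e.2 <;> simp only [e2, cond_true, cond_false] at h
    · cases e3 : hasLongThrough (addEdge A e.1 e.2) k e.1 e.2 <;>
        simp only [e3, cond_true, cond_false] at h
      · exact ih hal hl' h
      · exact ih (fun hA => (hal hA).clear hR h1 h2 (not_rel_of_hasLongThrough hR hA e3)) hl' h
    · exact ih hal hl' h

theorem table_sound {A al : ℕ} {l : List (ℕ × ℕ)} {K : List ℕ → Bool} (hR : Bounded R k)
    (hA : Below A R) (hal : Above al R) (hl : ∀ e ∈ l, e.1 < 16 ∧ e.2 < 16)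
    (h : table A k al l K = true) :
    ∃ t : List ℕ, (∀ n e, l[n]? = some e → R e.1 e.2 → Above (t.getD n 0) R) ∧ K t = true := by
  induction l generalizing K with
  | nil => exact ⟨[], by simp, h⟩
  | cons e l ih =>
    have hl' : ∀ e ∈ l, e.1 < 16 ∧ e.2 < 16 := fun e he => hl e (List.mem_cons_of_mem _ he)
    change (bif hasEdge al e.1 e.2 then
        bif hasEdge A e.1 e.2 then table A k al l fun t => K (al :: t) else
          force (addEdge A e.1 e.2) fun A' =>
            refine A' k l al fun al' => table A k al l fun t => K (al' :: t)
      else table A k al l fun t => K (0 :: t)) = true at h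
    have key : ∀ a, (R e.1 e.2 → Above a R) → (table A k al l fun t => K (a :: t)) = true →
        ∃ t : List ℕ, (∀ n e', (e :: l)[n]? = some e' → R e'.1 e'.2 → Above (t.getD n 0) R) ∧
          K t = true := by
      intro a ha h
      obtain ⟨t, ht, hK⟩ := ih hl' h
      refine ⟨a :: t, ?_, hK⟩
      rintro (_ | n) e' he' hRe
      · simp only [List.getElem?_cons_zero, Option.some.injEq] at he'
        subst he'; exact ha hRe
      · exact ht n e' (by simpa using he') hRe
    simp only [force_eq] at h
    cases e1 : hasEdge al e.1 e.2 <;> simp only [e1, cond_true, cond_false] at h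
    · refine key 0 (fun hRe => ?_) h
      rw [(hasEdge_iff _ _ _).2 (hal _ _ hRe)] at e1
      exact absurd e1.symm Bool.false_ne_true
    cases e2 : hasEdge A e.1 e.2 <;> simp only [e2, cond_true, cond_false] at h
    · obtain ⟨al', hal', h⟩ := refine_sound hR (fun _ => hal) hl' h
      exact key al' (fun hRe => hal' (hA.addEdge hR hRe)) h
    · exact key al (fun _ => hal) h

theorem getElem?_pairs :
    ∀ j < 10, ∀ i < j, pairs[pairIndex i j]? = some (i, j) ∧ pairs[pairIndex j i]? = some (i, j) := by
  decide

theorem lt_of_mem_pairs : ∀ e ∈ pairs, e.1 < 16 ∧ e.2 < 16 := by decide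

/-- The entries of the table `t` that belong to edges of `R` contain all edges of `R`. -/
def TableAbove (t : List ℕ) (R : ℕ → ℕ → Prop) : Prop :=
  ∀ n e, pairs[n]? = some e → R e.1 e.2 → Above (t.getD n 0) R

theorem TableAbove.above {t : List ℕ} (hR : Bounded R k) (ht : TableAbove t R) {i j : ℕ}
    (h : R i j) : Above (t.getD (pairIndex i j) 0) R := by
  have hi := hR.lt h
  have hj := hR.lt (hR.symm h)
  rcases lt_or_gt_of_ne (hR.ne h) with hij | hij
  · exact ht _ _ (getElem?_pairs j hj i hij).1 h
  · exact ht _ _ (getElem?_pairs i hi j hij).2 (hR.symm h)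

theorem step_sound {t : List ℕ} {A al a fr w : ℕ} {K : ℕ → ℕ → ℕ → ℕ → Bool}
    (hR : Bounded R k) (ht : TableAbove t R) (hA : Below A R) (hal : Above al R) (haw : R a w)
    (hw : fr.testBit w = true) (h : step t A al a fr K = true) :
    ∃ A' al', Below A' R ∧ Above al' R ∧ K A' al' w (Nat.xor fr (Nat.shiftLeft 1 w)) = true := by
  have h := allBit_sound h ((testBit_row_land al a w fr).2 ⟨hal _ _ haw, hw⟩)
  have hA' := hA.addEdge hR haw
  have hal' := hal.land (ht.above hR haw)
  simp only [force_eq] at h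
  rw [land_eq_of_below_of_above hA' hal', Nat.beq_refl, cond_true] at h
  exact ⟨_, _, hA', hal', h⟩

theorem testBit_of_cons {w fr : ℕ} {l : List ℕ} (hn : (w :: l).Nodup)
    (hfr : ∀ u ∈ w :: l, fr.testBit u = true) :
    ∀ u ∈ l, (Nat.xor fr (Nat.shiftLeft 1 w)).testBit u = true := by
  intro u hu
  rw [testBit_xor_shiftLeft]
  refine ⟨fun _ => ?_, fun _ => hfr u (List.mem_cons_of_mem _ hu)⟩
  rintro rfl
  exact (List.nodup_cons.1 hn).1 hu

theorem growEnd_eq_false {t : List ℕ} {A al a fr : ℕ} {l : List ℕ} (hR : Bounded R k)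
    (ht : TableAbove t R) (hA : Below A R) (hal : Above al R) (hl : (a :: l).IsChain R)
    (hn : l.Nodup) (hfr : ∀ u ∈ l, fr.testBit u = true) :
    growEnd k t l.length A al a fr = false := by
  rw [← Bool.not_eq_true]
  intro h
  induction l generalizing A al a fr with
  | nil => exact absurd ((hasLong_eq_false hR hA).symm.trans h) Bool.false_ne_true
  | cons w l ih =>
    rw [List.isChain_cons_cons] at hl
    obtain ⟨A', al', hA', hal', h⟩ :=
      step_sound hR ht hA hal hl.1 (hfr w List.mem_cons_self) h
    exact ih hA' hal' hl.2 (List.nodup_cons.1 hn).2 (testBit_of_cons hn hfr) h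

theorem growBoth_succ (k : ℕ) (t : List ℕ) (n r A al a b fr : ℕ) :
    growBoth k t (n + 1) r A al a b fr = bif Nat.beq r 0 then hasLong A k else
      step t A al a fr fun A' al' w fr' =>
        bif growEnd k t (Nat.sub r 1) A' al' w fr' then
          bif Nat.beq r 1 then true else
            step t A' al' b fr' fun A'' al'' z fr'' =>
              growBoth k t n (Nat.sub r 2) A'' al'' w z fr''
        else false := rfl

theorem growBoth_eq_false {t : List ℕ} {n A al a b fr : ℕ} {l l' : List ℕ} (hR : Bounded R k)
    (ht : TableAbove t R) (hA : Below A R) (hal : Above al R) (hl : (a :: l).IsChain R)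
    (hl' : (b :: l').IsChain R) (hn : (l ++ l').Nodup)
    (hfr : ∀ u ∈ l ++ l', fr.testBit u = true) (hle : l'.length ≤ l.length) :
    growBoth k t n (l.length + l'.length) A al a b fr = false := by
  rw [← Bool.not_eq_true]
  intro h
  induction n generalizing A al a b fr l l' with
  | zero => exact absurd h Bool.false_ne_true
  | succ n ih =>
    cases l with
    | nil =>
      have : l' = [] := by simpa using hle
      subst this
      rw [growBoth_succ, hasLong_eq_false hR hA] at h
      exact Bool.false_ne_true h
    | cons w l =>
      rw [List.isChain_cons_cons] at hl
      rw [List.cons_append] at hn hfr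
      have e : (w :: l).length + l'.length = l.length + l'.length + 1 := by
        simp only [List.length_cons]; omega
      have hb : Nat.beq (l.length + l'.length + 1) 0 = false := rfl
      have e1 : Nat.sub (l.length + l'.length + 1) 1 = l.length + l'.length := rfl
      rw [e, growBoth_succ, hb, cond_false, e1] at h
      obtain ⟨A', al', hA', hal', h⟩ :=
        step_sound hR ht hA hal hl.1 (hfr w List.mem_cons_self) h
      have hn' := (List.nodup_cons.1 hn).2
      have hfr' := testBit_of_cons hn hfr
      cases l' with
      | nil =>
        rw [List.append_nil] at hn' hfr'
        rw [List.length_nil, Nat.add_zero,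
          growEnd_eq_false hR ht hA' hal' hl.2 hn' hfr'] at h
        exact Bool.false_ne_true h
      | cons z l' =>
        rw [List.isChain_cons_cons] at hl'
        have hp : (l ++ z :: l').Perm (z :: (l ++ l')) := List.perm_middle
        have hn'' := hp.nodup_iff.1 hn'
        have hfr'' := fun u hu => hfr' u (hp.mem_iff.2 hu)
        cases hg : growEnd k t (l.length + (z :: l').length) A' al' w
            (Nat.xor fr (Nat.shiftLeft 1 w)) with
        | false => rw [hg] at h; exact Bool.false_ne_true h
        | true =>
          have hb : Nat.beq (l.length + (z :: l').length + 1) 1 = false := by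
            rw [← Bool.not_eq_true, Nat.beq_eq, List.length_cons]; omega
          rw [hg, cond_true, hb, cond_false] at h
          obtain ⟨A'', al'', hA'', hal'', h⟩ :=
            step_sound hR ht hA' hal' hl'.1 (hfr'' z List.mem_cons_self) h
          have e2 : Nat.sub (l.length + (z :: l').length + 1) 2 = l.length + l'.length := by
            rw [List.length_cons]; rfl
          rw [e2] at h
          refine ih hA'' hal'' hl.2 hl'.2 (List.nodup_cons.1 hn'').2
            (testBit_of_cons hn'' hfr'') ?_ h
          simpa using hle

theorem below_pathGraph (hR : Bounded R k) {n : ℕ} (h : ∀ i < n, R i (i + 1)) :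
    Below (pathGraph n) R := by
  induction n with
  | zero => intro i j _ hij; simp [pathGraph] at hij
  | succ n ih =>
    exact (ih fun i hi => h i (by omega)).addEdge hR (h n (by omega))

theorem search_eq_false {x : ℕ} {l l' : List ℕ} (hR : Bounded R k)
    (hP : ∀ i < k - 1, R i (i + 1)) (hx : R x k)
    (hl : (k :: l).IsChain R) (hl' : (k :: l').IsChain R) (hn : (k :: (l ++ l')).Nodup)
    (hlt : ∀ u ∈ l ++ l', u < 10 ∧ u ≠ x) (hle : l'.length ≤ l.length)
    (hlen : l.length + l'.length = k - 1) :
    search k x = false := by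
  rw [← Bool.not_eq_true]
  intro h
  change (force (addEdge (pathGraph (k - 1)) x k) fun A =>
    bif hasLong A k then true else
      refine A k pairs (2 ^ 160 - 1) fun al => table A k al pairs fun t =>
        growBoth k t k (k - 1) A al k k
          (Nat.xor (Nat.xor 1023 (Nat.shiftLeft 1 x)) (Nat.shiftLeft 1 k))) = true at h
  have hA := (below_pathGraph hR hP).addEdge hR hx
  rw [force_eq, hasLong_eq_false hR hA, cond_false] at h
  have hall : Above (2 ^ 160 - 1) R := by
    intro i j hij
    have hi := hR.lt hij
    have hj := hR.lt (hR.symm hij)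
    rw [Nat.testBit_two_pow_sub_one, decide_eq_true_iff]
    change 16 * i + j < 160
    omega
  obtain ⟨al, hal, h⟩ := refine_sound hR (fun _ => hall) lt_of_mem_pairs h
  obtain ⟨t, ht, h⟩ := table_sound hR hA (hal hA) lt_of_mem_pairs h
  have hfree : ∀ u ∈ l ++ l',
      (Nat.xor (Nat.xor 1023 (Nat.shiftLeft 1 x)) (Nat.shiftLeft 1 k)).testBit u = true := by
    intro u hu
    rw [testBit_xor_shiftLeft, testBit_xor_shiftLeft,
      show 1023 = 2 ^ 10 - 1 from rfl, Nat.testBit_two_pow_sub_one, decide_eq_true_iff]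
    have hk : u ≠ k := by rintro rfl; exact (List.nodup_cons.1 hn).1 hu
    simp [hlt u hu, hk]
  have hgrow := growBoth_eq_false (n := k) hR ht hA (hal hA) hl hl' (List.nodup_cons.1 hn).2
    hfree hle
  rw [hlen] at hgrow
  exact Bool.false_ne_true (hgrow.symm.trans h)

theorem search_eq_true :
    ((List.range 10).all fun k => (List.range ((k + 1) / 2)).all fun x => search k x) = true := by
  decide +kernel

section Lists

variable {V : Type*} {R : V → V → Prop}

theorem exists_connector {p q : List V} {m : List V} {u v : V}
    (hm : (u :: (m ++ [v])).IsChain R) (hn : (u :: (m ++ [v])).Nodup) (hu : u ∈ p) (hv : v ∈ q)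
    (hd : ∀ z ∈ u :: (m ++ [v]), ¬ (z ∈ p ∧ z ∈ q)) :
    ∃ x y T, x ∈ p ∧ x ∉ q ∧ y ∈ q ∧ y ∉ p ∧ (x :: (T ++ [y])).IsChain R ∧
      (x :: (T ++ [y])).Nodup ∧ ∀ z ∈ T, z ∉ p ∧ z ∉ q := by
  induction h : m.length using Nat.strong_induction_on generalizing m u v with
  | _ n ih =>
    by_cases hT : ∀ z ∈ m, z ∉ p ∧ z ∉ q
    · exact ⟨u, v, m, hu, fun h => hd u (by simp) ⟨hu, h⟩, hv, fun h => hd v (by simp) ⟨h, hv⟩,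
        hm, hn, hT⟩
    · have hT' : ∃ z ∈ m, z ∈ p ∨ z ∈ q := by
        by_contra! h'
        exact hT h'
      obtain ⟨z, hz, hz'⟩ := hT'
      obtain ⟨s, t, rfl⟩ := List.append_of_mem hz
      have e : u :: (s ++ z :: t ++ [v]) = (u :: s) ++ z :: (t ++ [v]) := by simp
      have e' : u :: (s ++ z :: t ++ [v]) = (u :: (s ++ [z])) ++ (t ++ [v]) := by simp
      rcases hz' with hz' | hz'
      · refine @ih t.length (by simp at h; omega) t z v ?_ ?_ hz' hv ?_ rfl
        · exact (e ▸ hm).right_of_append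
        · exact (e ▸ hn).of_append_right
        · exact fun w hw => hd w (by rw [e]; exact List.mem_append_right _ hw)
      · refine @ih s.length (by simp at h; omega) s u z ?_ ?_ hu hz' ?_ rfl
        · exact (e' ▸ hm).left_of_append
        · exact (e' ▸ hn).of_append_left
        · exact fun w hw => hd w (by rw [e']; exact List.mem_append_left _ hw)

/-- The relation `R` together with the pair `xy`. -/
def WithPair (R : V → V → Prop) (x y u v : V) : Prop :=
  R u v ∨ u = x ∧ v = y ∨ u = y ∧ v = x

theorem WithPair.symm (hs : ∀ {u v}, R u v → R v u) {x y u v : V} (h : WithPair R x y u v) :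
    WithPair R x y v u := by
  rcases h with h | h | h
  · exact Or.inl (hs h)
  · exact Or.inr (Or.inr h.symm)
  · exact Or.inr (Or.inl h.symm)

theorem exists_isChain_of_append {x y : V} {T l₁ l₂ : List V}
    (hT : (x :: (T ++ [y])).IsChain R) (hTn : T.Nodup)
    (hl : (l₁ ++ x :: y :: l₂).IsChain (WithPair R x y)) (hn : (l₁ ++ x :: y :: l₂).Nodup)
    (hd : ∀ z ∈ T, z ∉ l₁ ++ x :: y :: l₂) :
    ∃ l' : List V, l'.IsChain R ∧ l'.Nodup ∧ (l₁ ++ x :: y :: l₂).length ≤ l'.length := by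
  refine ⟨l₁ ++ x :: (T ++ y :: l₂), ?_, by grind [List.nodup_append], by simp⟩
  rw [List.isChain_append_cons_cons] at hl
  have h₁ : (l₁ ++ [x]).IsChain R := by
    refine hl.1.imp_of_mem_imp fun u v hu hv h => ?_
    rcases h with h | h | h
    · exact h
    · grind [List.nodup_append]
    · grind [List.nodup_append]
  have h₂ : (y :: l₂).IsChain R := by
    refine hl.2.2.imp_of_mem_imp fun u v hu hv h => ?_
    rcases h with h | h | h
    · exact h
    · grind [List.nodup_append]
    · grind [List.nodup_append]
  rw [List.isChain_split]
  refine ⟨h₁, ?_⟩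
  rw [← List.cons_append, List.isChain_split]
  exact ⟨hT, h₂⟩

theorem exists_isChain_of_withPair (hs : ∀ {u v}, R u v → R v u) {x y : V} {T l : List V}
    (hT : (x :: (T ++ [y])).IsChain R) (hTn : T.Nodup)
    (hl : l.IsChain (WithPair R x y)) (hn : l.Nodup) (hd : ∀ z ∈ T, z ∉ l) :
    ∃ l' : List V, l'.IsChain R ∧ l'.Nodup ∧ l.length ≤ l'.length := by
  by_cases h : ∃ l₁ l₂, l = l₁ ++ x :: y :: l₂
  · obtain ⟨l₁, l₂, rfl⟩ := h
    exact exists_isChain_of_append hT hTn hl hn hd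
  by_cases h' : ∃ l₁ l₂, l = l₁ ++ y :: x :: l₂
  · obtain ⟨l₁, l₂, rfl⟩ := h'
    have e : (l₁ ++ y :: x :: l₂).reverse = l₂.reverse ++ x :: y :: l₁.reverse := by simp
    have := exists_isChain_of_append (l₁ := l₂.reverse) (l₂ := l₁.reverse) hT hTn
      (by rw [← e, List.isChain_reverse]; exact hl.imp fun _ _ => WithPair.symm hs)
      (by rw [← e]; exact List.nodup_reverse.2 hn)
      (fun z hz => by rw [← e, List.mem_reverse]; exact hd z hz)
    rwa [← e, List.length_reverse] at this
  refine ⟨l, ?_, hn, le_rfl⟩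
  rw [List.isChain_iff_forall_rel_of_append_cons_cons] at hl ⊢
  intro a b l₁ l₂ e
  rcases hl e with h'' | ⟨rfl, rfl⟩ | ⟨rfl, rfl⟩
  · exact h''
  · exact (h ⟨_, _, e⟩).elim
  · exact (h' ⟨_, _, e⟩).elim

/-- The image of `R` restricted to the elements of `L` under the map `f`. -/
def Image (R : V → V → Prop) (L : List V) (f : V → ℕ) (i j : ℕ) : Prop :=
  ∃ u ∈ L, ∃ v ∈ L, f u = i ∧ f v = j ∧ R u v

theorem isChain_image {L l : List V} {f : V → ℕ} (hl : l.IsChain R) (h : ∀ u ∈ l, u ∈ L) :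
    (l.map f).IsChain (Image R L f) := by
  rw [List.isChain_map]
  exact hl.imp_of_mem_imp fun u v hu hv huv => ⟨u, h u hu, v, h v hv, rfl, rfl, huv⟩

theorem exists_map_eq {L : List V} {f : V → ℕ} (hf : ∀ u ∈ L, ∀ v ∈ L, f u = f v → u = v)
    {l : List ℕ} {u : V} (hu : u ∈ L) (hl : (f u :: l).IsChain (Image R L f)) :
    ∃ m : List V, m.map f = l ∧ (u :: m).IsChain R ∧ ∀ v ∈ m, v ∈ L := by
  induction l generalizing u with
  | nil => exact ⟨[], by simp⟩
  | cons j l ih =>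
    rw [List.isChain_cons_cons] at hl
    obtain ⟨⟨u', hu', v, hv, h, rfl, huv⟩, hl⟩ := hl
    obtain rfl := hf _ hu' _ hu h
    obtain ⟨m, rfl, hm, hm'⟩ := ih hv hl
    exact ⟨v :: m, rfl, List.isChain_cons_cons.2 ⟨huv, hm⟩, by simpa [hv] using hm'⟩

theorem false_of_split [Fintype V] [DecidableEq V] (hV : Fintype.card V ≤ 10)
    (hs : ∀ {u v}, R u v → R v u) (hirr : ∀ {u v}, R u v → u ≠ v)
    {p q p₁ p₂ B A T : List V} {x y : V} (hp : p = p₁ ++ x :: p₂) (hq : q = B.reverse ++ y :: A)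
    (hpc : p.IsChain R) (hpn : p.Nodup) (hqc : q.IsChain R) (hqn : q.Nodup)
    (hpq : p.length = q.length)
    (hmax : ∀ l : List V, l.IsChain R → l.Nodup → l.length ≤ p.length)
    (hT : (x :: (T ++ [y])).IsChain R) (hTn : T.Nodup) (hTd : ∀ z ∈ T, z ∉ p ∧ z ∉ q)
    (hxq : x ∉ q) (hyp : y ∉ p) (h₁ : p₁.length ≤ p₂.length) (h₂ : B.length ≤ A.length) :
    False := by
  set L : List V := p ++ y :: q.filter (fun z => z ∉ p ∧ z ≠ y) with hL
  have hLn : L.Nodup := by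
    have := hqn.filter (fun z => decide (z ∉ p ∧ z ≠ y))
    grind [List.nodup_append]
  have hL10 : L.length ≤ 10 := hLn.length_le_card.trans hV
  have hpL : ∀ u ∈ p, u ∈ L := fun u hu => List.mem_append_left _ hu
  have hqL : ∀ u ∈ q, u ∈ L := by grind
  have hLpq : ∀ u ∈ L, u ∈ p ∨ u ∈ q := by grind
  set f : V → ℕ := fun u => L.idxOf u with hf
  have hfi : ∀ u ∈ L, ∀ v ∈ L, f u = f v → u = v := fun u hu v _ h => (List.idxOf_inj hu).1 h
  have hf10 : ∀ u ∈ L, f u < 10 := fun u hu => (List.idxOf_lt_length_of_mem hu).trans_le hL10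
  have hfy : f y = p.length := by
    simp [hf, hL, List.idxOf_append_of_notMem hyp]
  have hxp : x ∈ p := by simp [hp]
  have hyq : y ∈ q := by simp [hq]
  have hxy : x ≠ y := fun h => hxq (h ▸ hyq)
  have hfp : ∀ i (hi : i < p.length), f p[i] = i := by
    intro i hi
    simp only [hf, hL]
    rw [List.idxOf_append_of_mem (List.getElem_mem hi), hpn.idxOf_getElem]
  have hfx : f x = p₁.length := by
    have := hfp p₁.length (by simp [hp])
    simpa [hp] using this
  set R' := WithPair R x y with hR'
  set S := Image R' L f with hS
  have hk : p.length < 10 := hfy ▸ hf10 y (hqL y hyq)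
  have hS' : Bounded S p.length :=
    { symm := by
        rintro i j ⟨u, hu, v, hv, h, h', huv⟩
        exact ⟨v, hv, u, hu, h', h, huv.symm hs⟩
      lt := by
        rintro i j ⟨u, hu, v, hv, rfl, h', huv⟩
        exact hf10 u hu
      ne := by
        rintro i j ⟨u, hu, v, hv, rfl, rfl, huv⟩ h
        obtain rfl := hfi _ hu _ hv h
        rcases huv with h | ⟨h, h'⟩ | ⟨h, h'⟩
        · exact hirr h rfl
        · exact hxy (h.symm.trans h')
        · exact hxy (h'.symm.trans h)
      le := by
        intro l hl hn
        have hpos : 1 ≤ p.length := List.length_pos_of_mem hxp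
        match l, hl, hn with
        | [], _, _ => simp
        | [i], _, _ => simpa using hpos
        | i :: j :: l, hl, hn =>
          obtain ⟨u, hu, v, hv, rfl, -, -⟩ := (List.isChain_cons_cons.1 hl).1
          obtain ⟨m, hm, hmc, hmL⟩ := exists_map_eq hfi hu hl
          have hlen : (f u :: j :: l).length = (u :: m).length := by
            rw [← hm]; simp
          have hmn : (u :: m).Nodup := by
            rw [← hm, ← List.map_cons] at hn
            exact hn.of_map
          have hd : ∀ z ∈ T, z ∉ u :: m := by
            intro z hz hz'
            have hzL : z ∈ L := by
              rcases List.mem_cons.1 hz' with rfl | h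
              · exact hu
              · exact hmL z h
            rcases hLpq z hzL with h | h
            · exact (hTd z hz).1 h
            · exact (hTd z hz).2 h
          obtain ⟨l', hl', hn', hle⟩ := exists_isChain_of_withPair hs hT hTn hmc hmn hd
          rw [hlen]
          exact hle.trans (hmax l' hl' hn') }
  have hlk : p.length = p₁.length + p₂.length + 1 := by simp [hp]; omega
  have hlq : p.length = A.length + B.length + 1 := by simp [hpq, hq]; omega
  have hmap : ∀ C : List V, (y :: C).map f = p.length :: C.map f := fun C => by simp [hfy]
  have hweak : ∀ C : List V, C.IsChain R → C.IsChain R' := fun C hC => hC.imp fun _ _ => Or.inl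
  have hAB : ∀ u ∈ y :: (A ++ B), u ∈ q := by simp [hq]; grind
  have hABn : (y :: (A ++ B)).Nodup := by
    have := hq ▸ hqn
    grind [List.nodup_append, List.nodup_reverse]
  have hfalse := search_eq_false (x := p₁.length) (l := A.map f) (l' := B.map f) hS'
    (fun i hi => ⟨p[i], hpL _ (List.getElem_mem _), p[i + 1], hpL _ (List.getElem_mem _),
      hfp _ _, hfp _ _, Or.inl (hpc.getElem i (by omega))⟩)
    ⟨x, hpL x hxp, y, hqL y hyq, hfx, hfy, Or.inr (Or.inl ⟨rfl, rfl⟩)⟩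
    (by
      rw [← hmap]
      refine isChain_image (hweak _ ?_) (by grind)
      exact (hq ▸ hqc).right_of_append)
    (by
      rw [← hmap]
      refine isChain_image (hweak _ ?_) (by grind)
      have : (B.reverse ++ [y]).IsChain R :=
        List.IsChain.left_of_append (l₂ := A) (by simpa using hq ▸ hqc)
      rw [← List.isChain_reverse] at this
      exact (by simpa using this : (y :: B).IsChain fun a b => R b a).imp fun _ _ => hs)
    (by
      rw [← List.map_append, ← hmap]
      exact hABn.map_on fun u hu v hv => hfi u (hqL u (hAB u hu)) v (hqL v (hAB v hv)))
    (by
      rw [← List.map_append]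
      intro i hi
      obtain ⟨u, hu, rfl⟩ := List.mem_map.1 hi
      have huq := hAB u (List.mem_cons_of_mem _ hu)
      refine ⟨hf10 u (hqL u huq), fun h => hxq ?_⟩
      rw [← hfx] at h
      rwa [← hfi _ (hqL u huq) _ (hpL x hxp) h])
    (by simpa using h₂) (by simp; omega)
  have htrue := search_eq_true
  simp only [List.all_eq_true, List.mem_range] at htrue
  rw [htrue p.length hk p₁.length (by omega)] at hfalse
  exact absurd hfalse (by simp)

theorem false_of_card_le_ten [Fintype V] (hV : Fintype.card V ≤ 10)
    (hs : ∀ {u v}, R u v → R v u) (hirr : ∀ {u v}, R u v → u ≠ v)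
    {p q T : List V} {x y : V}
    (hpc : p.IsChain R) (hpn : p.Nodup) (hqc : q.IsChain R) (hqn : q.Nodup)
    (hpq : p.length = q.length)
    (hmax : ∀ l : List V, l.IsChain R → l.Nodup → l.length ≤ p.length)
    (hT : (x :: (T ++ [y])).IsChain R) (hTn : T.Nodup) (hTd : ∀ z ∈ T, z ∉ p ∧ z ∉ q)
    (hxp : x ∈ p) (hxq : x ∉ q) (hyq : y ∈ q) (hyp : y ∉ p) : False := by
  classical
  have hrev : ∀ {l : List V}, l.IsChain R → l.reverse.IsChain R := fun hl =>
    List.isChain_reverse.2 (hl.imp fun _ _ => hs)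
  obtain ⟨p₁, p₂, hp⟩ := List.append_of_mem hxp
  obtain ⟨q₁, q₂, hq⟩ := List.append_of_mem hyq
  wlog h₁ : p₁.length ≤ p₂.length generalizing p p₁ p₂
  · exact this (p := p.reverse) (hrev hpc) (by simpa) (by simpa) (by simpa) (by simpa) (by simpa)
      (by simpa) p₂.reverse p₁.reverse (by simp [hp]) (by simp; omega)
  wlog h₂ : q₁.length ≤ q₂.length generalizing q q₁ q₂
  · exact this (q := q.reverse) (hrev hqc) (by simpa) (by simpa) (by simpa) q₂.reverse q₁.reverse
      (by simp [hq]) (by simpa) (by simpa) (by simp; omega)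
  exact false_of_split hV hs hirr (B := q₁.reverse) hp (by simpa using hq) hpc hpn hqc hqn hpq hmax
    hT hTn hTd hxq hyp h₁ (by simpa using h₂)

end Lists

theorem exists_support_eq {V : Type*} {G : SimpleGraph V} {u v : V} (W : G.Walk u v)
    (h : u ≠ v) : ∃ m, W.support = u :: (m ++ [v]) := by
  cases W with
  | nil => exact (h rfl).elim
  | cons _ W =>
    refine ⟨W.support.dropLast, ?_⟩
    have := List.dropLast_append_getLast W.support_ne_nil
    rw [Walk.getLast_support] at this
    rw [Walk.support_cons, this]

theorem exists_mem_notMem {V : Type*} {p q : List V} (hp : p.Nodup)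
    (h : p.length = q.length) (hne : {x | x ∈ p} ≠ {x | x ∈ q}) : ∃ x ∈ p, x ∉ q := by
  by_contra! h'
  have hs := List.subset_def.2 fun {x} => h' x
  have hperm := (hp.subperm hs).perm_of_length_le h.ge
  exact hne (Set.ext fun x => hperm.mem_iff)

theorem eleven_le_card {V : Type*} [Fintype V] {G : SimpleGraph V} {a b c d : V}
    {P : G.Walk a b} {Q : G.Walk c d} (hP : IsLongestPath G P) (hQ : IsLongestPath G Q)
    (hne : {x | x ∈ P.support} ≠ {x | x ∈ Q.support})
    (hc : (G.induce ({x | x ∈ P.support} ∩ {x | x ∈ Q.support})ᶜ).Connected) :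
    11 ≤ Fintype.card V := by
  have hlen := hP.length_support_eq hQ
  have hPn := hP.1.support_nodup
  have hQn := hQ.1.support_nodup
  obtain ⟨u, huP, huQ⟩ := exists_mem_notMem hPn hlen hne
  obtain ⟨v, hvQ, hvP⟩ := exists_mem_notMem hQn hlen.symm hne.symm
  obtain ⟨W, hW⟩ := hc.exists_isPath ⟨u, fun h => huQ h.2⟩ ⟨v, fun h => hvP h.1⟩
  have huv : u ≠ v := fun h => huQ (h ▸ hvQ)
  obtain ⟨m, hm⟩ : ∃ m, W.support.map Subtype.val = u :: (m ++ [v]) := by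
    obtain ⟨m, hm⟩ := exists_support_eq (W.map (Embedding.induce _).toHom) huv
    exact ⟨m, (Walk.support_map _ _).symm.trans hm⟩
  have hd : ∀ z ∈ u :: (m ++ [v]), ¬ (z ∈ P.support ∧ z ∈ Q.support) := by
    rw [← hm]
    intro z hz
    obtain ⟨w, -, rfl⟩ := List.mem_map.1 hz
    exact w.2
  have hmc : (u :: (m ++ [v])).IsChain G.Adj := by
    rw [← hm, List.isChain_map]
    exact W.isChain_adj_support
  have hmn : (u :: (m ++ [v])).Nodup := by
    rw [← hm]
    exact hW.support_nodup.map Subtype.val_injective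
  obtain ⟨x, y, T, hxP, hxQ, hyQ, hyP, hT, hTn, hTd⟩ := exists_connector hmc hmn huP hvQ hd
  by_contra! hlt
  exact false_of_card_le_ten (Nat.le_of_lt_succ hlt) (fun h => h.symm) (fun h => h.ne)
    P.isChain_adj_support hPn Q.isChain_adj_support hQn hlen (fun l hl hn => hP.length_le hl hn) hT
    (by grind [List.nodup_append]) hTd hxP hxQ hyQ hyP

section Example

def neighbors : Fin 11 → List (Fin 11) :=
  ![[1], [0, 2, 6], [1, 3, 10], [2, 4, 7], [3, 5], [4, 6, 10], [1, 5, 7], [3, 6, 8], [7, 9, 10],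
    [8], [2, 5, 8]]

def exampleGraph : SimpleGraph (Fin 11) where
  Adj u v := v ∈ neighbors u
  symm := ⟨by decide +kernel⟩
  loopless := ⟨by decide +kernel⟩

instance : DecidableRel exampleGraph.Adj := fun u v => inferInstanceAs (Decidable (v ∈ neighbors u))

/-- Is it impossible to prolong a path ending in `v` by `n` vertices which are not in `l`? -/
def stuck : ℕ → Fin 11 → List (Fin 11) → Bool
  | 0, _, _ => false
  | n + 1, v, l => (neighbors v).all fun w => l.contains w || stuck n w (w :: l)

theorem not_isChain_of_stuck {n : ℕ} {v : Fin 11} {l l' : List (Fin 11)} (h : stuck n v l = true)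
    (hl' : (v :: l').IsChain exampleGraph.Adj) (hn : l'.Nodup) (hd : ∀ w ∈ l', w ∉ l) :
    l'.length ≠ n := by
  induction n generalizing v l l' with
  | zero => simp [stuck] at h
  | succ n ih =>
    cases l' with
    | nil => simp
    | cons w l' =>
      rw [List.isChain_cons_cons] at hl'
      rw [List.nodup_cons] at hn
      have hw := List.all_eq_true.1 h w hl'.1
      simp only [Bool.or_eq_true, List.contains_iff_mem] at hw
      have := ih (hw.resolve_left (hd w (by simp))) hl'.2 hn.2 (by grind)
      simpa using this

theorem stuck_singleton : ∀ v, stuck 10 v [v] = true := by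
  decide +kernel

theorem exampleGraph_length_le {a b : Fin 11} {P : exampleGraph.Walk a b} (hP : P.IsPath) :
    P.length ≤ 9 := by
  have h := hP.length_lt
  have hs := P.cons_tail_support
  have hc := P.isChain_adj_support
  have hn := hP.support_nodup
  rw [← hs] at hc hn
  have h' := not_isChain_of_stuck (stuck_singleton a) hc (List.nodup_cons.1 hn).2
    (by grind)
  simp only [List.length_tail, Walk.length_support, Fintype.card_fin] at h h'
  omega

theorem exampleGraph_isLongestPath {l : List (Fin 11)} (hne : l ≠ [])
    (hl : l.IsChain exampleGraph.Adj) (hn : l.Nodup) (h : l.length = 10) :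
    IsLongestPath exampleGraph (Walk.ofSupport l hne hl) := by
  refine ⟨(Walk.isPath_def _).2 (by rwa [Walk.support_ofSupport]), fun Q hQ => ?_⟩
  rw [Walk.length_ofSupport, h]
  exact exampleGraph_length_le hQ

theorem exampleGraph_connected : exampleGraph.Connected := by
  have hl : ([0, 1, 2, 3, 4, 5, 6, 7, 8, 9] : List (Fin 11)).IsChain exampleGraph.Adj := by decide
  have h : ∀ v ∈ ([0, 1, 2, 3, 4, 5, 6, 7, 8, 9] : List (Fin 11)), exampleGraph.Reachable 0 v := by
    intro v hv
    rw [← Walk.support_ofSupport (by simp) hl] at hv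
    exact (Walk.takeUntil _ v hv).reachable
  rw [connected_iff_exists_forall_reachable]
  refine ⟨0, fun v => ?_⟩
  by_cases hv : v = 10
  · subst hv
    exact (h 2 (by decide)).trans (Adj.reachable (by decide))
  · exact h v (by revert v; decide)

end Example

end LongestPathSearch

/-- `11` is the least number of vertices of a connected simple graph
having two longest paths `P`, `Q` with `V(P) ≠ V(Q)` such that the subgraph induced
on the complement of `V(P) ∩ V(Q)` is connected. -/
theorem statement2 :
    IsLeast {n : ℕ | ∃ (G : SimpleGraph (Fin n)) (u₁ v₁ u₂ v₂ : Fin n)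
      (P : G.Walk u₁ v₁) (Q : G.Walk u₂ v₂),
      G.Connected ∧ IsLongestPath G P ∧ IsLongestPath G Q ∧
      {x | x ∈ P.support} ≠ {x | x ∈ Q.support} ∧
      (G.induce ({x | x ∈ P.support} ∩ {x | x ∈ Q.support})ᶜ).Connected} 11 := by
  open LongestPathSearch in
  constructor
  · refine ⟨exampleGraph, _, _, _, _,
      Walk.ofSupport [0, 1, 2, 3, 4, 5, 6, 7, 8, 9] (by simp) (by decide),
      Walk.ofSupport [0, 1, 6, 7, 3, 4, 5, 10, 8, 9] (by simp) (by decide),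
      exampleGraph_connected, exampleGraph_isLongestPath _ _ (by decide) rfl,
      exampleGraph_isLongestPath _ _ (by decide) rfl, ?_, ?_⟩
    · rw [Walk.support_ofSupport, Walk.support_ofSupport]
      exact fun h => absurd ((Set.ext_iff.1 h 2).1 (by decide)) (by decide)
    · rw [Walk.support_ofSupport, Walk.support_ofSupport]
      have e : ({x | x ∈ [0, 1, 2, 3, 4, 5, 6, 7, 8, 9]} ∩
          {x | x ∈ [0, 1, 6, 7, 3, 4, 5, 10, 8, 9]} : Set (Fin 11))ᶜ = {2, 10} := by
        ext v
        simp only [Set.mem_compl_iff, Set.mem_inter_iff, Set.mem_ofPred_eq, Set.mem_insert_iff,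
          Set.mem_singleton_iff]
        revert v
        decide
      rw [e]
      exact induce_pair_connected_of_adj (by decide)
  · rintro n ⟨G, _, _, _, _, P, Q, -, hP, hQ, hne, hc⟩
    simpa using eleven_le_card hP hQ hne hc
end

section
/- There is no connected simple graph G on exactly 8 vertices having two longest paths P and Q with V(P) ≠ V(Q) and |V(P) ∩ V(Q)| = 6 such that the subgraph of G induced on V(G) \ (V(P) ∩ V(Q)) is connected. Equivalently, for every connected simple graph G on 8 vertices, if P and Q are longest paths with V(P) ≠ V(Q) and |V(P) ∩ V(Q)| = 6, then V(P) ∩ V(Q) is a separator of G. -/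
open SimpleGraph

/-- A vertex avoided by a path on seven vertices cannot be inserted into it if there is no Hamiltonian
path. -/
theorem not_adj_of_forall_not_isChain {V : Type*} {G : SimpleGraph V}
    (H : ∀ l : List V, l.Nodup → l.IsChain G.Adj → l.length ≠ 8) {y a₁ a₂ a₃ a₄ a₅ a₆ a₇ : V}
    (hnodup : [y, a₁, a₂, a₃, a₄, a₅, a₆, a₇].Nodup)
    (hchain : [a₁, a₂, a₃, a₄, a₅, a₆, a₇].IsChain G.Adj) :
    ¬ G.Adj y a₁ ∧ ¬ G.Adj y a₇ ∧ ¬ (G.Adj y a₁ ∧ G.Adj y a₂) ∧ ¬ (G.Adj y a₂ ∧ G.Adj y a₃) ∧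
      ¬ (G.Adj y a₃ ∧ G.Adj y a₄) ∧ ¬ (G.Adj y a₄ ∧ G.Adj y a₅) ∧ ¬ (G.Adj y a₅ ∧ G.Adj y a₆) ∧
      ¬ (G.Adj y a₆ ∧ G.Adj y a₇) := by
  have key (s t : List V) (hst : s ++ t = [a₁, a₂, a₃, a₄, a₅, a₆, a₇])
      (h : (s ++ y :: t).IsChain G.Adj) : False := by
    refine H (s ++ y :: t) ?_ h ?_
    · rwa [List.nodup_middle, hst]
    · have := congrArg List.length hst
      simp only [List.length_append, List.length_cons, List.length_nil] at this ⊢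
      omega
  simp only [List.isChain_cons_cons, List.IsChain.singleton, and_true] at hchain
  obtain ⟨h₁, h₂, h₃, h₄, h₅, h₆⟩ := hchain
  refine ⟨fun h ↦ key [] _ rfl ?_, fun h ↦ key [a₁, a₂, a₃, a₄, a₅, a₆, a₇] [] rfl ?_,
    fun h ↦ key [a₁] _ rfl ?_, fun h ↦ key [a₁, a₂] _ rfl ?_,
    fun h ↦ key [a₁, a₂, a₃] _ rfl ?_, fun h ↦ key [a₁, a₂, a₃, a₄] _ rfl ?_,
    fun h ↦ key [a₁, a₂, a₃, a₄, a₅] _ rfl ?_,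
    fun h ↦ key [a₁, a₂, a₃, a₄, a₅, a₆] _ rfl ?_⟩ <;> simp [*, G.adj_comm _ y]

/-- If two vertices `x`, `y` are adjacent, `l₁ ++ u :: x :: v :: l₂` is a path avoiding only `y`,
and there is no Hamiltonian path, then any two further neighbours `c`, `d` of `y` are distinct from
`u` and `v`, and are matched by edges to the two remaining vertices. -/
theorem exists_adj_adj_of_forall_not_isChain {V : Type*} {G : SimpleGraph V}
    (H : ∀ l : List V, l.Nodup → l.IsChain G.Adj → l.length ≠ 8)
    {x y u v c d : V} {l₁ l₂ : List V} (hxy : G.Adj x y)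
    (hlen : (l₁ ++ u :: x :: v :: l₂).length = 7)
    (hnodup : (y :: (l₁ ++ u :: x :: v :: l₂)).Nodup)
    (hchain : (l₁ ++ u :: x :: v :: l₂).IsChain G.Adj)
    (hc : c ∈ l₁ ++ u :: x :: v :: l₂) (hd : d ∈ l₁ ++ u :: x :: v :: l₂)
    (hcd : c ≠ d) (hcx : c ≠ x) (hdx : d ≠ x) (hyc : G.Adj y c) (hyd : G.Adj y d) :
    ∃ p q, [x, y, u, v, c, d, p, q].Nodup ∧ G.Adj c p ∧ G.Adj d q := by
  have hyx := hxy.symm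
  rcases l₁ with - | ⟨a₁, - | ⟨a₂, - | ⟨a₃, - | ⟨a₄, - | ⟨a₅, l₁⟩⟩⟩⟩⟩ <;>
  rcases l₂ with - | ⟨b₁, - | ⟨b₂, - | ⟨b₃, - | ⟨b₄, - | ⟨b₅, l₂⟩⟩⟩⟩⟩ <;>
  simp only [List.nil_append, List.cons_append, List.length_cons, List.length_append,
    List.length_nil] at hlen <;> try omega
  all_goals
    simp only [List.nil_append, List.cons_append] at hnodup hchain hc hd
    have hy := not_adj_of_forall_not_isChain H hnodup hchain
    clear H
    simp only [List.mem_cons, List.not_mem_nil, or_false] at hc hd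
    simp only [List.isChain_cons_cons, List.IsChain.singleton, and_true] at hchain
  · have : c = b₁ ∧ d = b₃ ∨ c = b₃ ∧ d = b₁ := by grind
    rcases this with ⟨rfl, rfl⟩ | ⟨rfl, rfl⟩
    · exact ⟨b₂, b₄, by grind, by grind, by grind⟩
    · exact ⟨b₄, b₂, by grind, by grind [G.adj_comm], by grind⟩
  · grind
  · have : c = a₂ ∧ d = b₁ ∨ c = b₁ ∧ d = a₂ := by grind
    rcases this with ⟨rfl, rfl⟩ | ⟨rfl, rfl⟩
    · exact ⟨a₁, b₂, by grind, by grind [G.adj_comm], by grind⟩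
    · exact ⟨b₂, a₁, by grind, by grind, by grind [G.adj_comm]⟩
  · grind
  · have : c = a₂ ∧ d = a₄ ∨ c = a₄ ∧ d = a₂ := by grind
    rcases this with ⟨rfl, rfl⟩ | ⟨rfl, rfl⟩
    · exact ⟨a₁, a₃, by grind, by grind [G.adj_comm], by grind [G.adj_comm]⟩
    · exact ⟨a₃, a₁, by grind, by grind [G.adj_comm], by grind [G.adj_comm]⟩

/-- If `x` and `y` are adjacent and there is no Hamiltonian path, a path avoiding only `y` has `x`
as an interior vertex. -/
theorem exists_eq_append_of_forall_not_isChain {V : Type*} {G : SimpleGraph V}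
    (H : ∀ l : List V, l.Nodup → l.IsChain G.Adj → l.length ≠ 8)
    {x y : V} {l : List V} (hxy : G.Adj x y) (hlen : l.length = 7) (hnodup : l.Nodup)
    (hchain : l.IsChain G.Adj) (hx : x ∈ l) (hy : y ∉ l) :
    ∃ l₁ u v l₂, l = l₁ ++ u :: x :: v :: l₂ := by
  obtain ⟨s, t, rfl⟩ := List.append_of_mem hx
  rcases t with - | ⟨v, t⟩
  · refine (H (s ++ [x, y]) ?_ ?_ (by grind)).elim
    · have := hxy.ne
      simp_all [List.nodup_append]
      grind
    · rw [List.isChain_split]; simp_all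
  rcases s.eq_nil_or_concat with rfl | ⟨s, u, rfl⟩
  · exact (H (y :: x :: v :: t) (by simp_all) (by simp_all [G.adj_comm]) (by simp_all)).elim
  · exact ⟨s, u, v, t, by simp⟩

/-- A graph on eight vertices has a Hamiltonian path if it has two paths on seven vertices avoiding
respectively the adjacent vertices `y` and `x`. -/
theorem exists_isChain_of_adj {V : Type*} [Fintype V] {G : SimpleGraph V}
    (hcard : Fintype.card V = 8) {x y : V} {l m : List V} (hxy : G.Adj x y)
    (hl : l.length = 7) (hm : m.length = 7) (hlnodup : l.Nodup) (hmnodup : m.Nodup)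
    (hlchain : l.IsChain G.Adj) (hmchain : m.IsChain G.Adj) (hyl : y ∉ l) (hxm : x ∉ m) :
    ∃ k : List V, k.Nodup ∧ k.IsChain G.Adj ∧ k.length = 8 := by
  by_contra! H
  have hmem {k : List V} (hk : k.Nodup) (hk' : k.length = 8) (z : V) : z ∈ k := by
    classical
    have : k.toFinset = Finset.univ := by
      rw [← Finset.card_eq_iff_eq_univ, List.toFinset_card_of_nodup hk, hk', hcard]
    simpa [← List.mem_toFinset] using this ▸ Finset.mem_univ z
  have hl' := hmem (List.nodup_cons.2 ⟨hyl, hlnodup⟩) (by simp [hl])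
  have hm' := hmem (List.nodup_cons.2 ⟨hxm, hmnodup⟩) (by simp [hm])
  have hxl : x ∈ l := (List.mem_cons.1 (hl' x)).resolve_left hxy.ne
  have hym : y ∈ m := (List.mem_cons.1 (hm' y)).resolve_left hxy.ne'
  obtain ⟨l₁, u, v, l₂, rfl⟩ :=
    exists_eq_append_of_forall_not_isChain H hxy hl hlnodup hlchain hxl hyl
  obtain ⟨m₁, c, d, m₂, rfl⟩ :=
    exists_eq_append_of_forall_not_isChain H hxy.symm hm hmnodup hmchain hym hxm
  have huxv : G.Adj u x ∧ G.Adj x v := by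
    simp_all [List.isChain_append]
  have hcyd : G.Adj c y ∧ G.Adj y d := by
    simp_all [List.isChain_append]
  have huv : u ≠ v := by grind
  have hcd : c ≠ d := by grind
  have huy : u ≠ y := by grind
  have hvy : v ≠ y := by grind
  have hcx : c ≠ x := by grind
  have hdx : d ≠ x := by grind
  obtain ⟨p, q, hpq, hcp, hdq⟩ := exists_adj_adj_of_forall_not_isChain H hxy hl
    (List.nodup_cons.2 ⟨hyl, hlnodup⟩) hlchain
    ((List.mem_cons.1 (hl' c)).resolve_left hcyd.1.ne)
    ((List.mem_cons.1 (hl' d)).resolve_left hcyd.2.ne') hcd hcx hdx hcyd.1.symm hcyd.2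
  obtain ⟨r, s, hrs, hur, hvs⟩ := exists_adj_adj_of_forall_not_isChain H hxy.symm hm
    (List.nodup_cons.2 ⟨hxm, hmnodup⟩) hmchain
    ((List.mem_cons.1 (hm' u)).resolve_left huxv.1.ne)
    ((List.mem_cons.1 (hm' v)).resolve_left huxv.2.ne') huv huy hvy huxv.1.symm huxv.2
  have hr := hmem hpq rfl r
  have hs := hmem hpq rfl s
  have : r = p ∧ s = q ∨ r = q ∧ s = p := by
    clear * - hpq hrs hr hs
    grind
  rcases this with ⟨rfl, rfl⟩ | ⟨rfl, rfl⟩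
  · exact H [c, r, u, x, v, s, d, y] (by clear * - hpq; grind)
      (by simp [hcp, hur.symm, huxv, hvs, hdq.symm, hcyd.2.symm]) rfl
  · exact H [c, s, v, x, u, r, d, y] (by clear * - hpq; grind)
      (by simp [hcp, hvs.symm, huxv.2.symm, huxv.1.symm, hur, hdq.symm, hcyd.2.symm]) rfl

/-- for every connected simple graph `G` on 8 vertices, if `P` and `Q`
are longest paths with `V(P) ≠ V(Q)` and `|V(P) ∩ V(Q)| = 6`, then `V(P) ∩ V(Q)` is a
separator of `G`, i.e. the subgraph induced on its complement is not connected. -/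
theorem statement3 {V : Type*} [Fintype V] (G : SimpleGraph V)
    (hG : G.Connected) (hcard : Fintype.card V = 8)
    {u₁ v₁ u₂ v₂ : V} (P : G.Walk u₁ v₁) (Q : G.Walk u₂ v₂)
    (hP : IsLongestPath G P) (hQ : IsLongestPath G Q)
    (hne : {x | x ∈ P.support} ≠ {x | x ∈ Q.support})
    (hint : ({x | x ∈ P.support} ∩ {x | x ∈ Q.support}).ncard = 6) :
    ¬ (G.induce ({x | x ∈ P.support} ∩ {x | x ∈ Q.support})ᶜ).Connected := by
  classical
  intro hconn
  have hncard {a b : V} {R : G.Walk a b} (hR : R.IsPath) :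
      {x | x ∈ R.support}.ncard = R.length + 1 := by
    rw [← R.length_support, ← List.toFinset_card_of_nodup hR.support_nodup,
      ← Set.ncard_coe_finset, List.coe_toFinset]
  have hlen : P.length = Q.length := le_antisymm (hQ.2 P hP.1) (hP.2 Q hQ.1)
  have hPc := hncard hP.1
  have hQc := hncard hQ.1
  have hPQ : ¬ {x | x ∈ P.support} ⊆ {x | x ∈ Q.support} := fun h ↦
    hne (Set.eq_of_subset_of_ncard_le h (by omega))
  have hQP : ¬ {x | x ∈ Q.support} ⊆ {x | x ∈ P.support} := fun h ↦
    hne (Set.eq_of_subset_of_ncard_le h (by omega)).symm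
  obtain ⟨x, hxP, hxQ⟩ := Set.not_subset.1 hPQ
  obtain ⟨y, hyQ, hyP⟩ := Set.not_subset.1 hQP
  have hxy : x ≠ y := fun h ↦ hxQ (h ▸ hyQ)
  have hcompl : ({x | x ∈ P.support} ∩ {x | x ∈ Q.support})ᶜ.ncard = 2 := by
    have := Set.ncard_add_ncard_compl ({x | x ∈ P.support} ∩ {x | x ∈ Q.support})
    rw [hint, Nat.card_eq_fintype_card, hcard] at this
    omega
  have hcompl' : {x, y} = ({x | x ∈ P.support} ∩ {x | x ∈ Q.support})ᶜ :=
    Set.eq_of_subset_of_ncard_le (by rintro z (rfl | rfl) <;> simp_all)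
      (by rw [hcompl, Set.ncard_pair hxy])
  have hlength : P.length = 6 := by
    have h₁ : ({x | x ∈ P.support} ∩ {x | x ∈ Q.support}).ncard < {x | x ∈ P.support}.ncard :=
      Set.ncard_lt_ncard (Set.inter_ssubset_left_iff.2 hPQ)
    have h₂ : {x | x ∈ P.support}.ncard < Nat.card V := Set.ncard_lt_card fun h ↦
      hyP (h ▸ Set.mem_univ y)
    rw [Nat.card_eq_fintype_card] at h₂
    omega
  have hadj : G.Adj x y := by
    rw [← hcompl'] at hconn
    have : Nontrivial ({x, y} : Set V) := ⟨⟨x, by simp⟩, ⟨y, by simp⟩, by simpa using hxy⟩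
    obtain ⟨⟨z, hz⟩, h⟩ := hconn.preconnected.exists_adj_of_nontrivial ⟨x, by simp⟩
    rcases hz with rfl | rfl
    · simp at h
    · simpa using h
  obtain ⟨k, hk, hk', hk''⟩ := exists_isChain_of_adj hcard hadj (by simp [hlength])
    (by simp [← hlen, hlength]) hP.1.support_nodup hQ.1.support_nodup P.isChain_adj_support
    Q.isChain_adj_support hyP hxQ
  have hne : k ≠ [] := by rintro rfl; simp at hk''
  have := hP.2 (Walk.ofSupport k hne hk')
    ((Walk.isPath_def _).2 (by rwa [Walk.support_ofSupport]))
  rw [Walk.length_ofSupport] at this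
  omega
end

section
/- There is no simple graph G on exactly 10 vertices having two longest paths P and Q with |V(P) ∩ V(Q)| = 6 and |V(P) \ V(Q)| = |V(Q) \ V(P)| = 2 (so V(G) = V(P) ∪ V(Q)) such that the subgraph of G induced on V(G) \ (V(P) ∩ V(Q)) is connected. -/
open SimpleGraph

/-- A path leaving a longest path `P` between the positions `i` and `j` and avoiding `P` in between
is no longer than the segment of `P` that it bypasses. -/
theorem IsLongestPath.detour_length_le {V : Type*} {G : SimpleGraph V} {u v x y : V}
    {P : G.Walk u v} (hP : IsLongestPath G P) {R : G.Walk x y} (hR : R.IsPath)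
    (hdisj : ∀ z ∈ R.support, z ∉ P.support) {i j : ℕ} (hij : i < j) (hj : j ≤ P.length)
    (hx : G.Adj (P.getVert i) x) (hy : G.Adj y (P.getVert j)) :
    R.length + 2 ≤ j - i := by
  let W := (P.take i).append (Walk.cons hx (R.append (Walk.cons hy (P.drop j))))
  have hsup : W.support = P.support.take (i + 1) ++ (R.support ++ P.support.drop j) := by
    simp [W, Walk.support_append, Walk.support_take, Walk.drop_support_eq_support_drop_min, hj]
  have hsub : (P.support.take (i + 1) ++ P.support.drop j).Sublist P.support := by
    conv_rhs => rw [← List.take_append_drop (i + 1) P.support]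
    exact (List.Sublist.refl _).append (List.drop_sublist_drop_left _ hij)
  have hW : W.IsPath := by
    rw [Walk.isPath_def, hsup]
    have hnd := List.nodup_append.1 (hP.1.support_nodup.sublist hsub)
    refine List.nodup_append.2 ⟨hnd.1, List.nodup_append.2 ⟨hR.support_nodup, hnd.2.1, ?_⟩, ?_⟩
    · rintro a ha b hb rfl
      exact hdisj a ha (List.mem_of_mem_drop hb)
    · rintro a ha b hb rfl
      rcases List.mem_append.1 hb with hb | hb
      · exact hdisj a hb (List.mem_of_mem_take ha)
      · exact hnd.2.2 a ha a hb rfl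
  have hlen := hP.2 W hW
  have hW' : W.length = i + (R.length + (P.length - j + 1) + 1) := by
    simp [W, Walk.length_append, Walk.take_length, Walk.drop_length]
    omega
  omega

/-- A path attached to a longest path `P` at position `i`, and otherwise avoiding `P`, is no longer
than the initial segment of `P` it could replace. -/
theorem IsLongestPath.tail_length_lt {V : Type*} {G : SimpleGraph V} {u v x y : V}
    {P : G.Walk u v} (hP : IsLongestPath G P) {R : G.Walk y x} (hR : R.IsPath)
    (hdisj : ∀ z ∈ R.support, z ∉ P.support) {i : ℕ} (hi : i ≤ P.length)
    (hx : G.Adj x (P.getVert i)) : R.length < i := by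
  let W := R.append (Walk.cons hx (P.drop i))
  have hsup : W.support = R.support ++ P.support.drop i := by
    simp [W, Walk.support_append, Walk.drop_support_eq_support_drop_min, hi]
  have hW : W.IsPath := by
    rw [Walk.isPath_def, hsup]
    refine List.nodup_append.2 ⟨hR.support_nodup,
      hP.1.support_nodup.sublist (List.drop_sublist _ _), ?_⟩
    rintro a ha b hb rfl
    exact hdisj a ha (List.mem_of_mem_drop hb)
  have hlen := hP.2 W hW
  have hW' : W.length = R.length + (P.length - i + 1) := by
    simp [W, Walk.length_append, Walk.drop_length]
  omega

theorem IsLongestPath.reverse {V : Type*} {G : SimpleGraph V} {u v : V} {P : G.Walk u v}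
    (hP : IsLongestPath G P) : IsLongestPath G P.reverse :=
  ⟨hP.1.reverse, fun R hR => by simpa using hP.2 R hR⟩

theorem IsLongestPath.lt_length_sub {V : Type*} {G : SimpleGraph V} {u v x y : V}
    {P : G.Walk u v} (hP : IsLongestPath G P) {R : G.Walk y x} (hR : R.IsPath)
    (hdisj : ∀ z ∈ R.support, z ∉ P.support) {i : ℕ} (hi : i ≤ P.length)
    (hx : G.Adj x (P.getVert i)) : R.length < P.length - i := by
  refine hP.reverse.tail_length_lt hR (by simpa using hdisj) (by simp) ?_
  rwa [Walk.getVert_reverse, Nat.sub_sub_self hi]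

section LengthSeven

variable {V : Type*} {G : SimpleGraph V} {u v x y : V} {P : G.Walk u v}

theorem IsLongestPath.pos_of_adj (hP : IsLongestPath G P) (hl : P.length = 7)
    (hx : x ∉ P.support) {i : ℕ} (hi : i ≤ 7) (h : G.Adj x (P.getVert i)) : 1 ≤ i ∧ i ≤ 6 := by
  have h1 := hP.tail_length_lt (R := (Walk.nil : G.Walk x x)) (by simp) (by simpa using hx)
    (by omega) h
  have h2 := hP.lt_length_sub (R := (Walk.nil : G.Walk x x)) (by simp) (by simpa using hx)
    (by omega) h
  simp at h1 h2
  omega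

theorem IsLongestPath.add_two_le_of_adj (hP : IsLongestPath G P) (hl : P.length = 7)
    (hx : x ∉ P.support) {i j : ℕ} (hj : j ≤ 7) (hij : i < j)
    (h : G.Adj x (P.getVert i)) (h' : G.Adj x (P.getVert j)) : i + 2 ≤ j := by
  have h1 := hP.detour_length_le (R := (Walk.nil : G.Walk x x)) (by simp) (by simpa using hx)
    hij (by omega) h.symm h'
  simp at h1
  omega

theorem IsLongestPath.pos_of_adj_of_adj (hP : IsLongestPath G P) (hl : P.length = 7)
    (hx : x ∉ P.support) (hy : y ∉ P.support) (hxy : G.Adj x y) {i : ℕ} (hi : i ≤ 7)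
    (h : G.Adj x (P.getVert i)) : 2 ≤ i ∧ i ≤ 5 := by
  have hR : hxy.symm.toWalk.IsPath := by simp [hxy.ne.symm]
  have hd : ∀ z ∈ hxy.symm.toWalk.support, z ∉ P.support := by simp [hx, hy]
  have h1 := hP.tail_length_lt hR hd (by omega) h
  have h2 := hP.lt_length_sub hR hd (by omega) h
  simp at h1 h2
  omega

theorem IsLongestPath.add_three_le_of_adj (hP : IsLongestPath G P) (hl : P.length = 7)
    (hx : x ∉ P.support) (hy : y ∉ P.support) (hxy : G.Adj x y) {i j : ℕ} (hj : j ≤ 7)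
    (hij : i < j) (h : G.Adj x (P.getVert i)) (h' : G.Adj y (P.getVert j)) : i + 3 ≤ j := by
  have h1 := hP.detour_length_le (R := hxy.toWalk) (by simp [hxy.ne]) (by simp [hx, hy])
    hij (by omega) h.symm h'
  simp at h1
  omega

theorem exists_pos_of_mem (hl : P.length = 7) (hx : x ∈ P.support) :
    ∃ i ≤ 7, P.getVert i = x := by
  obtain ⟨i, h, hi⟩ := Walk.mem_support_iff_exists_getVert.1 hx
  exact ⟨i, hl ▸ hi, h⟩

/-- A vertex off a longest path with eight vertices has at most three neighbours on it. -/
theorem IsLongestPath.not_four_adj (hP : IsLongestPath G P) (hl : P.length = 7)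
    (hx : x ∉ P.support) {a b c d : V} (ha : a ∈ P.support) (hb : b ∈ P.support)
    (hc : c ∈ P.support) (hd : d ∈ P.support) (hxa : G.Adj x a) (hxb : G.Adj x b)
    (hxc : G.Adj x c) (hxd : G.Adj x d) (hab : a ≠ b) (hac : a ≠ c) (had : a ≠ d)
    (hbc : b ≠ c) (hbd : b ≠ d) (hcd : c ≠ d) : False := by
  obtain ⟨i, hi, rfl⟩ := exists_pos_of_mem hl ha
  obtain ⟨j, hj, rfl⟩ := exists_pos_of_mem hl hb
  obtain ⟨k, hk, rfl⟩ := exists_pos_of_mem hl hc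
  obtain ⟨m, hm, rfl⟩ := exists_pos_of_mem hl hd
  have key : ∀ s t, s ≤ 7 → t ≤ 7 → G.Adj x (P.getVert s) → G.Adj x (P.getVert t) →
      P.getVert s ≠ P.getVert t → s + 2 ≤ t ∨ t + 2 ≤ s := by
    intro s t hs ht h h' hne
    rcases lt_trichotomy s t with hst | rfl | hst
    · exact Or.inl (hP.add_two_le_of_adj hl hx ht hst h h')
    · exact absurd rfl hne
    · exact Or.inr (hP.add_two_le_of_adj hl hx hs hst h' h)
  have := hP.pos_of_adj hl hx hi hxa
  have := hP.pos_of_adj hl hx hj hxb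
  have := hP.pos_of_adj hl hx hk hxc
  have := hP.pos_of_adj hl hx hm hxd
  have := key i j hi hj hxa hxb hab
  have := key i k hi hk hxa hxc hac
  have := key i m hi hm hxa hxd had
  have := key j k hj hk hxb hxc hbc
  have := key j m hj hm hxb hxd hbd
  have := key k m hk hm hxc hxd hcd
  omega

/-- If `x` and `y` are adjacent vertices off a longest path with eight vertices, then `x` has at
most two neighbours on the path. -/
theorem IsLongestPath.not_three_adj (hP : IsLongestPath G P) (hl : P.length = 7)
    (hx : x ∉ P.support) (hy : y ∉ P.support) (hxy : G.Adj x y) {a b c : V}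
    (ha : a ∈ P.support) (hb : b ∈ P.support) (hc : c ∈ P.support) (hxa : G.Adj x a)
    (hxb : G.Adj x b) (hxc : G.Adj x c) (hab : a ≠ b) (hac : a ≠ c) (hbc : b ≠ c) : False := by
  obtain ⟨i, hi, rfl⟩ := exists_pos_of_mem hl ha
  obtain ⟨j, hj, rfl⟩ := exists_pos_of_mem hl hb
  obtain ⟨k, hk, rfl⟩ := exists_pos_of_mem hl hc
  have key : ∀ s t, s ≤ 7 → t ≤ 7 → G.Adj x (P.getVert s) → G.Adj x (P.getVert t) →
      P.getVert s ≠ P.getVert t → s + 2 ≤ t ∨ t + 2 ≤ s := by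
    intro s t hs ht h h' hne
    rcases lt_trichotomy s t with hst | rfl | hst
    · exact Or.inl (hP.add_two_le_of_adj hl hx ht hst h h')
    · exact absurd rfl hne
    · exact Or.inr (hP.add_two_le_of_adj hl hx hs hst h' h)
  have := hP.pos_of_adj_of_adj hl hx hy hxy hi hxa
  have := hP.pos_of_adj_of_adj hl hx hy hxy hj hxb
  have := hP.pos_of_adj_of_adj hl hx hy hxy hk hxc
  have := key i j hi hj hxa hxb hab
  have := key i k hi hk hxa hxc hac
  have := key j k hj hk hxb hxc hbc
  omega

/-- If `x` and `y` are adjacent vertices off a longest path with eight vertices and `x` has two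
neighbours on the path, then `y` has no further neighbour on it. -/
theorem IsLongestPath.not_two_adj_one_adj (hP : IsLongestPath G P) (hl : P.length = 7)
    (hx : x ∉ P.support) (hy : y ∉ P.support) (hxy : G.Adj x y) {a b c : V}
    (ha : a ∈ P.support) (hb : b ∈ P.support) (hc : c ∈ P.support) (hxa : G.Adj x a)
    (hxb : G.Adj x b) (hyc : G.Adj y c) (hab : a ≠ b) (hac : a ≠ c) (hbc : b ≠ c) : False := by
  obtain ⟨i, hi, rfl⟩ := exists_pos_of_mem hl ha
  obtain ⟨j, hj, rfl⟩ := exists_pos_of_mem hl hb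
  obtain ⟨k, hk, rfl⟩ := exists_pos_of_mem hl hc
  have key : ∀ s, s ≤ 7 → G.Adj x (P.getVert s) → P.getVert s ≠ P.getVert k →
      s + 3 ≤ k ∨ k + 3 ≤ s := by
    intro s hs h hne
    rcases lt_trichotomy s k with hst | rfl | hst
    · exact Or.inl (hP.add_three_le_of_adj hl hx hy hxy hk hst h hyc)
    · exact absurd rfl hne
    · exact Or.inr (hP.add_three_le_of_adj hl hy hx hxy.symm hs hst hyc h)
  have hij : i ≠ j := fun h => hab (by rw [h])
  have := hP.pos_of_adj_of_adj hl hx hy hxy hi hxa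
  have := hP.pos_of_adj_of_adj hl hx hy hxy hj hxb
  have := hP.pos_of_adj_of_adj hl hy hx hxy.symm hk hyc
  have := key i hi hxa hac
  have := key j hj hxb hbc
  omega

theorem IsLongestPath.getVert_ne (hP : IsLongestPath G P) (hl : P.length = 7) {i j : ℕ}
    (hi : i ≤ 7) (hj : j ≤ 7) (hij : i ≠ j) : P.getVert i ≠ P.getVert j :=
  fun h => hij (hP.1.getVert_injOn (by simpa [hl] using hi) (by simpa [hl] using hj) h)

/-- A vertex of a longest path with a neighbour off the path is an inner vertex. -/
theorem IsLongestPath.exists_two_adj (hP : IsLongestPath G P) (hl : P.length = 7) {p : V}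
    (hp : p ∈ P.support) (hx : x ∉ P.support) (hpx : G.Adj p x) :
    ∃ a b, a ∈ P.support ∧ b ∈ P.support ∧ a ≠ b ∧ G.Adj p a ∧ G.Adj p b := by
  obtain ⟨k, hk, rfl⟩ := exists_pos_of_mem hl hp
  have h := hP.pos_of_adj hl hx hk hpx.symm
  obtain ⟨k, rfl⟩ := Nat.exists_eq_add_of_le' h.1
  exact ⟨P.getVert k, P.getVert (k + 2), P.getVert_mem_support _, P.getVert_mem_support _,
    hP.getVert_ne hl (by omega) (by omega) (by omega),
    (P.adj_getVert_succ (by omega)).symm, P.adj_getVert_succ (by omega)⟩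

/-- The neighbours along a longest path of two of its vertices `p`, `p'`, where `p` has a neighbour
off the path. -/
theorem IsLongestPath.adj_cases (hP : IsLongestPath G P) (hl : P.length = 7) {p p' : V}
    (hp : p ∈ P.support) (hp' : p' ∈ P.support) (hne : p ≠ p') (hx : x ∉ P.support)
    (hpx : G.Adj p x) :
    (∃ a b, (a ∈ P.support ∧ a ≠ p ∧ a ≠ p') ∧ (b ∈ P.support ∧ b ≠ p ∧ b ≠ p') ∧ a ≠ b ∧
      G.Adj p a ∧ G.Adj p b) ∨
    (∃ a b, (a ∈ P.support ∧ a ≠ p ∧ a ≠ p') ∧ (b ∈ P.support ∧ b ≠ p ∧ b ≠ p') ∧ a ≠ b ∧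
      G.Adj p a ∧ G.Adj p' b) ∨
    ((∃ a, (a ∈ P.support ∧ a ≠ p ∧ a ≠ p') ∧ G.Adj p a) ∧
      ∀ y, y ∉ P.support → ¬ G.Adj p' y ∧ ¬ G.Adj x y) := by
  obtain ⟨k, hk, rfl⟩ := exists_pos_of_mem hl hp
  obtain ⟨m, hm, rfl⟩ := exists_pos_of_mem hl hp'
  have hkm : k ≠ m := fun h => hne (by rw [h])
  have h := hP.pos_of_adj hl hx hk hpx.symm
  have hmem : ∀ i, i ≤ 7 → i ≠ k → i ≠ m →
      P.getVert i ∈ P.support ∧ P.getVert i ≠ P.getVert k ∧ P.getVert i ≠ P.getVert m :=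
    fun i hi h1 h2 => ⟨P.getVert_mem_support _, hP.getVert_ne hl hi hk h1,
      hP.getVert_ne hl hi hm h2⟩
  have hadj : ∀ i j, i ≤ 7 → j ≤ 7 → i + 1 = j ∨ j + 1 = i → G.Adj (P.getVert i) (P.getVert j) := by
    rintro i j hi hj (rfl | rfl)
    · exact P.adj_getVert_succ (by omega)
    · exact (P.adj_getVert_succ (by omega)).symm
  have hend : m = 0 ∨ m = 7 → k ≤ 1 ∨ 6 ≤ k →
      ∀ y, y ∉ P.support → ¬ G.Adj (P.getVert m) y ∧ ¬ G.Adj x y := by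
    intro h0 h1 y hy
    refine ⟨fun h' => ?_, fun h' => ?_⟩
    · have := hP.pos_of_adj hl hy hm h'.symm
      omega
    · have := hP.pos_of_adj_of_adj hl hx hy h' hk hpx.symm
      omega
  by_cases h1 : m = k + 1
  · by_cases h2 : m = 7
    · exact Or.inr (Or.inr ⟨⟨P.getVert (k - 1), hmem _ (by omega) (by omega) (by omega),
        hadj _ _ (by omega) (by omega) (by omega)⟩, hend (by omega) (by omega)⟩)
    · exact Or.inr (Or.inl ⟨P.getVert (k - 1), P.getVert (m + 1),
        hmem _ (by omega) (by omega) (by omega), hmem _ (by omega) (by omega) (by omega),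
        hP.getVert_ne hl (by omega) (by omega) (by omega),
        hadj _ _ (by omega) (by omega) (by omega), hadj _ _ (by omega) (by omega) (by omega)⟩)
  by_cases h3 : k = m + 1
  · by_cases h2 : m = 0
    · exact Or.inr (Or.inr ⟨⟨P.getVert (k + 1), hmem _ (by omega) (by omega) (by omega),
        hadj _ _ (by omega) (by omega) (by omega)⟩, hend (by omega) (by omega)⟩)
    · exact Or.inr (Or.inl ⟨P.getVert (k + 1), P.getVert (m - 1),
        hmem _ (by omega) (by omega) (by omega), hmem _ (by omega) (by omega) (by omega),
        hP.getVert_ne hl (by omega) (by omega) (by omega),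
        hadj _ _ (by omega) (by omega) (by omega), hadj _ _ (by omega) (by omega) (by omega)⟩)
  exact Or.inl ⟨P.getVert (k - 1), P.getVert (k + 1),
    hmem _ (by omega) (by omega) (by omega), hmem _ (by omega) (by omega) (by omega),
    hP.getVert_ne hl (by omega) (by omega) (by omega),
    hadj _ _ (by omega) (by omega) (by omega), hadj _ _ (by omega) (by omega) (by omega)⟩

variable {p p' q q' : V} {w₁ w₂ : V} {Q : G.Walk w₁ w₂}

/-- If `V(P) \ V(Q) = {p, p'}` with `p` and `p'` adjacent, and `q ∈ V(Q) \ V(P)` is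
adjacent to `p`, then no other vertex of `V(Q) \ V(P)` is adjacent to `q`, `p` or `p'`. -/
theorem IsLongestPath.not_adj_of_adj (hP : IsLongestPath G P) (hQ : IsLongestPath G Q)
    (hPl : P.length = 7) (hQl : Q.length = 7)
    (hdiff : ∀ z, z ∈ P.support ∧ z ∉ Q.support ↔ z = p ∨ z = p') (hpp : G.Adj p p')
    (hq : q ∈ Q.support ∧ q ∉ P.support) (hq' : q' ∈ Q.support ∧ q' ∉ P.support) (hqq : q ≠ q')
    (hpq : G.Adj p q) : ¬ G.Adj q q' ∧ ¬ G.Adj p q' ∧ ¬ G.Adj p' q' := by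
  have hp := (hdiff p).2 (Or.inl rfl)
  have hp' := (hdiff p').2 (Or.inr rfl)
  have hmem : ∀ a, a ∈ P.support ∧ a ≠ p ∧ a ≠ p' → a ∈ Q.support := by
    intro a ha
    by_contra h
    rcases (hdiff a).1 ⟨ha.1, h⟩ with h | h
    exacts [ha.2.1 h, ha.2.2 h]
  have hneq : ∀ a, a ∈ P.support ∧ a ≠ p ∧ a ≠ p' → a ≠ q := by
    rintro a ha rfl
    exact hq.2 ha.1
  rcases hP.adj_cases hPl hp.1 hp'.1 hpp.ne hq.2 hpq with
    ⟨a, b, ha, hb, hab, hpa, hpb⟩ | ⟨a, b, ha, hb, hab, hpa, hpb⟩ | ⟨⟨a, ha, hpa⟩, h⟩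
  · exact (hQ.not_three_adj hQl hp.2 hp'.2 hpp (hmem a ha) (hmem b hb) hq.1 hpa hpb hpq hab
      (hneq a ha) (hneq b hb)).elim
  · exact (hQ.not_two_adj_one_adj hQl hp.2 hp'.2 hpp (hmem a ha) hq.1 (hmem b hb) hpa hpq hpb
      (hneq a ha) hab (hneq b hb).symm).elim
  · refine ⟨(h q' hq'.2).2, fun h' => ?_, (h q' hq'.2).1⟩
    refine hQ.not_three_adj hQl hp.2 hp'.2 hpp (hmem a ha) hq.1 hq'.1 hpa hpq h' (hneq a ha)
      ?_ hqq
    exact fun h => hq'.2 (h ▸ ha.1)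

/-- If `V(Q) \ V(P) = {q, q'}` with `q` and `q'` not adjacent, then `q` has at most one neighbour
in `V(P) \ V(Q)`. -/
theorem IsLongestPath.not_adj_of_not_adj (hP : IsLongestPath G P) (hQ : IsLongestPath G Q)
    (hPl : P.length = 7) (hQl : Q.length = 7)
    (hdiff : ∀ z, z ∈ Q.support ∧ z ∉ P.support ↔ z = q ∨ z = q') (hqq : ¬ G.Adj q q')
    (hp : p ∈ P.support ∧ p ∉ Q.support) (hp' : p' ∈ P.support ∧ p' ∉ Q.support) (hpp : p ≠ p')
    (hpq : G.Adj q p) : ¬ G.Adj q p' := by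
  intro hpq'
  have hq := (hdiff q).2 (Or.inl rfl)
  obtain ⟨a, b, ha, hb, hab, hqa, hqb⟩ := hQ.exists_two_adj hQl hq.1 hp.2 hpq
  have hmem : ∀ a, a ∈ Q.support → G.Adj q a → a ∈ P.support := by
    intro a ha hqa
    by_contra h
    rcases (hdiff a).1 ⟨ha, h⟩ with rfl | rfl
    exacts [G.irrefl hqa, hqq hqa]
  have hne : ∀ {a b}, a ∈ Q.support → b ∉ Q.support → a ≠ b := by
    rintro a b ha hb rfl
    exact hb ha
  exact hP.not_four_adj hPl hq.2 (hmem a ha hqa) (hmem b hb hqb) hp.1 hp'.1 hqa hqb hpq hpq' hab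
    (hne ha hp.2) (hne ha hp'.2) (hne hb hp.2) (hne hb hp'.2) hpp

end LengthSeven

/-- A connected induced subgraph has an edge across every cut. -/
theorem exists_adj_of_induce_connected {V : Type*} {G : SimpleGraph V} {T : Set V}
    (hT : (G.induce T).Connected) (S : Set V) {a b : V} (ha : a ∈ T) (hb : b ∈ T)
    (haS : a ∈ S) (hbS : b ∉ S) : ∃ c ∈ T, ∃ d ∈ T, c ∈ S ∧ d ∉ S ∧ G.Adj c d := by
  obtain ⟨w⟩ := hT.preconnected ⟨a, ha⟩ ⟨b, hb⟩
  obtain ⟨d, -, h1, h2⟩ := w.exists_boundary_dart {z | z.1 ∈ S} haS hbS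
  exact ⟨d.fst, d.fst.2, d.snd, d.snd.2, h1, h2, d.adj⟩

theorem SimpleGraph.Walk.IsPath.ncard_support {V : Type*} {G : SimpleGraph V} {u v : V}
    {P : G.Walk u v} (hP : P.IsPath) : {x | x ∈ P.support}.ncard = P.length + 1 := by
  classical
  have h : {x | x ∈ P.support} = (P.support.toFinset : Set V) := by ext; simp
  rw [h, Set.ncard_coe_finset, List.toFinset_card_of_nodup hP.support_nodup, Walk.length_support]

/-- there is no simple graph on exactly 10 vertices with two longest paths
`P`, `Q` such that `|V(P) ∩ V(Q)| = 6`, `|V(P) \ V(Q)| = |V(Q) \ V(P)| = 2` and the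
subgraph induced on the complement of `V(P) ∩ V(Q)` is connected. -/
theorem statement6 {V : Type*} [Fintype V] (G : SimpleGraph V)
    (hcard : Fintype.card V = 10)
    {u₁ v₁ u₂ v₂ : V} (P : G.Walk u₁ v₁) (Q : G.Walk u₂ v₂)
    (hP : IsLongestPath G P) (hQ : IsLongestPath G Q)
    (hint : ({x | x ∈ P.support} ∩ {x | x ∈ Q.support}).ncard = 6)
    (hPQ : ({x | x ∈ P.support} \ {x | x ∈ Q.support}).ncard = 2)
    (hQP : ({x | x ∈ Q.support} \ {x | x ∈ P.support}).ncard = 2) :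
    ¬ (G.induce ({x | x ∈ P.support} ∩ {x | x ∈ Q.support})ᶜ).Connected := by
  intro hconn
  obtain ⟨p, p', hpp, hPQ'⟩ := Set.ncard_eq_two.1 hPQ
  obtain ⟨q, q', hqq, hQP'⟩ := Set.ncard_eq_two.1 hQP
  have hPl : P.length = 7 := by
    have h := Set.ncard_inter_add_ncard_sdiff_eq_ncard {x | x ∈ P.support} {x | x ∈ Q.support}
      (Set.toFinite _)
    rw [hP.1.ncard_support] at h
    omega
  have hQl : Q.length = 7 := by
    have := hP.2 Q hQ.1
    have := hQ.2 P hP.1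
    omega
  have hunion : ∀ z, z ∈ P.support ∨ z ∈ Q.support := by
    have h := Set.ncard_union_add_ncard_inter {x | x ∈ P.support} {x | x ∈ Q.support}
    rw [hP.1.ncard_support, hQ.1.ncard_support] at h
    have h' : ({x | x ∈ P.support} ∪ {x | x ∈ Q.support} : Set V) = Set.univ := by
      rw [Set.eq_univ_iff_ncard, Nat.card_eq_fintype_card]
      omega
    exact fun z => h'.symm.subset (Set.mem_univ z)
  have hdP : ∀ z, z ∈ P.support ∧ z ∉ Q.support ↔ z = p ∨ z = p' := fun z =>
    Set.ext_iff.1 hPQ' z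
  have hdQ : ∀ z, z ∈ Q.support ∧ z ∉ P.support ↔ z = q ∨ z = q' := fun z =>
    Set.ext_iff.1 hQP' z
  have hp := (hdP p).2 (Or.inl rfl)
  have hp' := (hdP p').2 (Or.inr rfl)
  have hq := (hdQ q).2 (Or.inl rfl)
  have hq' := (hdQ q').2 (Or.inr rfl)
  have hT : ∀ z, z ∈ ({x | x ∈ P.support} ∩ {x | x ∈ Q.support} : Set V)ᶜ ↔
      z = p ∨ z = p' ∨ z = q ∨ z = q' := by
    intro z
    have := hunion z
    have := hdP z
    have := hdQ z
    simp only [Set.mem_compl_iff, Set.mem_inter_iff, Set.mem_ofPred_eq]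
    tauto
  have hcut := fun S a b ha hb => exists_adj_of_induce_connected hconn S (a := a) (b := b)
    ((hT a).2 ha) ((hT b).2 hb)
  simp only [hT] at hcut
  have hdP' := fun z => (hdP z).trans or_comm
  have hdQ' := fun z => (hdQ z).trans or_comm
  have hpq : p ≠ q := by rintro rfl; exact hp.2 hq.1
  have hpq' : p ≠ q' := by rintro rfl; exact hp.2 hq'.1
  have hp'q : p' ≠ q := by rintro rfl; exact hp'.2 hq.1
  have hp'q' : p' ≠ q' := by rintro rfl; exact hp'.2 hq'.1
  have c1 := hcut {p, p'} p q (by simp) (by simp) (by simp) (by simp [hpq.symm, hp'q.symm])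
  have c2 := hcut {p} p q (by simp) (by simp) (by simp) (by simp [hpq.symm])
  have c3 := hcut {p'} p' q (by simp) (by simp) (by simp) (by simp [hp'q.symm])
  have c4 := hcut {q} q p (by simp) (by simp) (by simp) (by simp [hpq])
  have c5 := hcut {q'} q' p (by simp) (by simp) (by simp) (by simp [hpq'])
  have c6 := hcut {p, q} p q' (by simp) (by simp) (by simp) (by simp [hpq'.symm, hqq.symm])
  have c7 := hcut {p, q'} p q (by simp) (by simp) (by simp) (by simp [hpq.symm, hqq])
  simp only [or_and_right, exists_or, exists_eq_left, Set.mem_insert_iff, Set.mem_singleton_iff,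
    hpp, hpp.symm, hqq, hqq.symm, hpq, hpq.symm, hpq', hpq'.symm, hp'q, hp'q.symm, hp'q', hp'q'.symm,
    or_true, or_false, false_or, not_true_eq_false, not_false_eq_true, true_and,
    false_and] at c1 c2 c3 c4 c5 c6 c7
  have a1 := fun h => hP.not_adj_of_adj hQ hPl hQl hdP h hq hq' hqq
  have a2 := fun h => hP.not_adj_of_adj hQ hPl hQl hdP h hq' hq hqq.symm
  have a3 := fun h => hP.not_adj_of_adj hQ hPl hQl hdP' h hq hq' hqq
  have a4 := fun h => hP.not_adj_of_adj hQ hPl hQl hdP' h hq' hq hqq.symm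
  have b1 := fun h => hQ.not_adj_of_adj hP hQl hPl hdQ h hp hp' hpp
  have b2 := fun h => hQ.not_adj_of_adj hP hQl hPl hdQ h hp' hp hpp.symm
  have b3 := fun h => hQ.not_adj_of_adj hP hQl hPl hdQ' h hp hp' hpp
  have b4 := fun h => hQ.not_adj_of_adj hP hQl hPl hdQ' h hp' hp hpp.symm
  have d1 := fun h => hP.not_adj_of_not_adj hQ hPl hQl hdQ h hp hp' hpp
  have d2 := fun h => hP.not_adj_of_not_adj hQ hPl hQl hdQ' h hp hp' hpp
  simp only [G.adj_comm p' p, G.adj_comm q' q, G.adj_comm q p, G.adj_comm q p', G.adj_comm q' p,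
    G.adj_comm q' p'] at a3 a4 b1 b2 b3 b4 c3 c4 c5 c6 c7 d1 d2
  clear hcut hT hconn hdP hdQ hdP' hdQ' hunion
  grind only
end
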